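/- arXiv:2407.12837 — 14 statements merged into one kernel-verified Lean document; each statement's English description precedes it below -/
import Mathlib

section
/- If max{2−β, β} < δ ≤ 2−β+2√(1−β), then: f maps E into E; s ∈ (0, 1/k); f is strictly increasing on [0, s] and strictly decreasing on [s, 1/k]; f(0) ≥ 0; f(1/k) < 1/k; and f(Y) > Y for every Y ∈ (0, s]. -/
open Set

/-- The nonlinear macrodynamics map `f(Y) = β·Y + δ·Y·(1 − k·Y)`. -/
noncomputable def f (β k δ : ℝ) : ℝ → ℝ := fun Y => β * Y + δ * Y * (1 - k * Y)

/-- The critical point `s = (β + δ)/(2δk)`. -/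
noncomputable def s (β k δ : ℝ) : ℝ := (β + δ) / (2 * δ * k)

theorem stmt_0 (β k δ : ℝ) (hβ0 : 0 < β) (hβ1 : β < 1) (hk : 0 < k) (hδ : 0 < δ)
    (hlow : max (2 - β) β < δ) (hhigh : δ ≤ 2 - β + 2 * Real.sqrt (1 - β)) :
    Set.MapsTo (f β k δ) (Set.Icc 0 (1 / k)) (Set.Icc 0 (1 / k)) ∧
    s β k δ ∈ Set.Ioo 0 (1 / k) ∧
    StrictMonoOn (f β k δ) (Set.Icc 0 (s β k δ)) ∧
    StrictAntiOn (f β k δ) (Set.Icc (s β k δ) (1 / k)) ∧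
    0 ≤ f β k δ 0 ∧
    f β k δ (1 / k) < 1 / k ∧
    ∀ Y ∈ Set.Ioc 0 (s β k δ), Y < f β k δ Y := by
  obtain ⟨h2, hβδ⟩ := max_lt_iff.mp hlow
  have hδk : 0 < δ * k := mul_pos hδ hk
  have hs : 2 * (δ * k) * s β k δ = β + δ := by
    unfold s
    field_simp
  have hk1 : k * (1 / k) = 1 := by field_simp
  have hsq : (β + δ) ^ 2 ≤ 4 * δ := by
    have h1 := Real.sq_sqrt (sub_nonneg.mpr hβ1.le)
    have h3 : (δ - (2 - β)) ^ 2 ≤ (2 * Real.sqrt (1 - β)) ^ 2 :=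
      pow_le_pow_left₀ (by linarith) (by linarith) 2
    linarith
  have hdiff : ∀ x y, f β k δ y - f β k δ x = (y - x) * (δ * k) * (2 * s β k δ - x - y) := by
    intro x y
    simp only [f]
    linear_combination (x - y) * hs
  refine ⟨?_, ⟨?_, ?_⟩, ?_, ?_, ?_, ?_, ?_⟩
  · rintro Y ⟨hY0, hY1⟩
    have hkY : k * Y ≤ 1 := hk1 ▸ mul_le_mul_of_nonneg_left hY1 hk.le
    refine ⟨add_nonneg (mul_nonneg hβ0.le hY0)
      (mul_nonneg (mul_nonneg hδ.le hY0) (sub_nonneg.mpr hkY)), ?_⟩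
    rw [le_div_iff₀ hk]
    refine le_of_mul_le_mul_left ?_ (mul_pos four_pos hδ)
    simp only [f]
    linarith [sq_nonneg (2 * δ * (k * Y) - (β + δ))]
  · unfold s
    positivity
  · unfold s
    rw [div_lt_div_iff₀ (by positivity) hk]
    nlinarith
  · rintro x ⟨_, hx⟩ y ⟨_, hy⟩ hxy
    refine sub_pos.mp (hdiff x y ▸ ?_)
    exact mul_pos (mul_pos (sub_pos.mpr hxy) hδk) (by linarith)
  · rintro x ⟨hx, _⟩ y ⟨hy, _⟩ hxy
    refine sub_neg.mp (hdiff x y ▸ ?_)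
    exact mul_neg_of_pos_of_neg (mul_pos (sub_pos.mpr hxy) hδk) (by linarith)
  · simp [f]
  · have h1 : f β k δ (1 / k) = β * (1 / k) := by
      simp only [f, hk1]
      ring
    rw [h1]
    exact mul_lt_of_lt_one_left (by positivity) hβ1
  · rintro Y ⟨hY0, hY⟩
    have h1 := mul_le_mul_of_nonneg_left hY hδk.le
    have h3 : 0 < Y * (β + δ - δ * k * Y - 1) := mul_pos hY0 (by linarith)
    simp only [f]
    linarith
end

section
/- If max{2−β, β} < δ ≤ 2−β+2√(1−β), then f (viewed as a map of E = [0,1/k] to itself) has an odd period cycle if and only if j(δ) > 0, where j(δ) = δ³ + 3βδ² − 2δ² + 3β²δ − 4βδ − 4δ + β³ − 2β² − 4β − 8 (equivalently, δ > 3.68 − β approximately). -/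
open Set

/-- The cubic `j(δ) = δ³ + 3βδ² − 2δ² + 3β²δ − 4βδ − 4δ + β³ − 2β² − 4β − 8`. -/
noncomputable def j (β : ℝ) : ℝ → ℝ := fun δ =>
  δ ^ 3 + 3 * β * δ ^ 2 - 2 * δ ^ 2 + 3 * β ^ 2 * δ - 4 * β * δ - 4 * δ
    + β ^ 3 - 2 * β ^ 2 - 4 * β - 8

open Function

/-- The logistic map with parameter `a`. -/
def logistic (a : ℝ) : ℝ → ℝ := fun x => a * x * (1 - x)

lemma logistic_le (a x : ℝ) (ha : 0 ≤ a) : logistic a x ≤ a / 4 := by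
  unfold logistic
  nlinarith [mul_nonneg ha (sq_nonneg (x - 1 / 2))]

lemma continuous_logistic (a : ℝ) : Continuous (logistic a) := by
  unfold logistic
  fun_prop

lemma minimalPeriod_logistic_of_eq {a x : ℝ} (h : logistic a x = x) :
    minimalPeriod (logistic a) x = 1 :=
  minimalPeriod_eq_one_iff_isFixedPt.2 h

lemma logistic_eq_self {a x : ℝ} (ha : 0 < a) (h : logistic a x = x) (hx : x ≠ 0) :
    x = 1 - 1 / a := by
  unfold logistic at h
  have : a * (1 - x) = 1 := mul_left_cancel₀ hx (by linarith)
  field_simp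
  linarith

/-- The logistic map takes `[1/a, 1 - 1/a]` above its nonzero fixed point `1 - 1/a`. -/
lemma le_logistic {a x : ℝ} (ha : 0 < a) (h₁ : 1 / a ≤ x) (h₂ : x ≤ 1 - 1 / a) :
    1 - 1 / a ≤ logistic a x := by
  have h : logistic a x - (1 - 1 / a) = a * ((x - 1 / a) * (1 - 1 / a - x)) := by
    unfold logistic
    field_simp
    ring
  have := mul_nonneg ha.le (mul_nonneg (sub_nonneg.2 h₁) (sub_nonneg.2 h₂))
  linarith

lemma logistic_le_of_le {a x : ℝ} (ha : 2 < a) (h : 1 - 1 / a ≤ x) :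
    logistic a x ≤ 1 - 1 / a := by
  have ha' : 1 / a < 1 / 2 := one_div_lt_one_div_of_lt two_pos ha
  have e : logistic a x - (1 - 1 / a) = - (a * ((x - 1 / a) * (x - (1 - 1 / a)))) := by
    unfold logistic
    field_simp
    ring
  have := mul_nonneg (by linarith : (0 : ℝ) ≤ a)
    (mul_nonneg (by linarith : 0 ≤ x - 1 / a) (sub_nonneg.2 h))
  linarith

/-- When the cubic is nonpositive, the image of `[1 - 1/a, a/4]` stays above `1/a`. -/
lemma one_div_le_logistic {a x : ℝ} (ha : 2 < a) (hj : a ^ 3 - 2 * a ^ 2 - 4 * a - 8 ≤ 0)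
    (h₁ : 1 - 1 / a ≤ x) (h₂ : x ≤ a / 4) : 1 / a ≤ logistic a x := by
  have ha' : 1 / a < 1 / 2 := one_div_lt_one_div_of_lt two_pos ha
  have h : logistic a (a / 4) ≤ logistic a x := by
    unfold logistic
    nlinarith [mul_nonneg (by linarith : (0 : ℝ) ≤ a)
      (mul_nonneg (sub_nonneg.2 h₂) (by linarith : 0 ≤ a / 4 + x - 1))]
  refine le_trans ?_ h
  unfold logistic
  rw [div_le_iff₀ (by linarith)]
  nlinarith [mul_nonneg (by linarith : 0 ≤ a - 2) (neg_nonneg.2 hj)]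

lemma iterate_logistic_two_mul_mem {a x : ℝ} {s : Set ℝ}
    (h : ∀ y ∈ s, logistic a (logistic a y) ∈ s) (hx : x ∈ s) (n : ℕ) :
    (logistic a)^[2 * n] x ∈ s := by
  rw [iterate_mul]
  exact MapsTo.iterate (f := (logistic a)^[2]) (fun y hy => h y hy) n hx

/-- When the cubic is nonpositive the intervals on both sides of the fixed point are swapped, so
there are no odd cycles. -/
lemma not_odd_minimalPeriod_of_mem {a x : ℝ} (ha : 2 < a)
    (hj : a ^ 3 - 2 * a ^ 2 - 4 * a - 8 ≤ 0) (h₁ : 1 / a ≤ x) (h₂ : x ≤ a / 4)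
    (hp : 1 < minimalPeriod (logistic a) x) : ¬ Odd (minimalPeriod (logistic a) x) := by
  rintro ⟨n, hn⟩
  have ha0 : 0 < a := by linarith
  have hAB : ∀ y ∈ Icc (1 / a) (1 - 1 / a), logistic a y ∈ Icc (1 - 1 / a) (a / 4) :=
    fun y hy => ⟨le_logistic ha0 hy.1 hy.2, logistic_le a y ha0.le⟩
  have hBA : ∀ y ∈ Icc (1 - 1 / a) (a / 4), logistic a y ∈ Icc (1 / a) (1 - 1 / a) :=
    fun y hy => ⟨one_div_le_logistic ha hj hy.1 hy.2, logistic_le_of_le ha hy.1⟩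
  have hper : logistic a ((logistic a)^[2 * n] x) = x := by
    rw [← iterate_succ_apply' (logistic a), Nat.succ_eq_add_one, ← hn]
    exact iterate_minimalPeriod
  have hx : x = 1 - 1 / a := by
    rcases le_total x (1 - 1 / a) with hx | hx
    · have := hAB _ (iterate_logistic_two_mul_mem
        (fun y hy => hBA _ (hAB y hy)) ⟨h₁, hx⟩ n)
      rw [hper] at this
      exact le_antisymm hx this.1
    · have := hBA _ (iterate_logistic_two_mul_mem
        (fun y hy => hAB _ (hBA y hy)) ⟨hx, h₂⟩ n)
      rw [hper] at this
      exact le_antisymm this.2 hx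
  have hfix : logistic a x = x := by
    rw [hx]
    unfold logistic
    field_simp
    ring
  rw [minimalPeriod_logistic_of_eq hfix] at hp
  exact lt_irrefl _ hp

lemma not_odd_minimalPeriod {a x : ℝ} (ha : 2 < a) (hx : 0 ≤ x)
    (hj : a ^ 3 - 2 * a ^ 2 - 4 * a - 8 ≤ 0) (hp : 1 < minimalPeriod (logistic a) x) :
    ¬ Odd (minimalPeriod (logistic a) x) := by
  have ha0 : 0 < a := by linarith
  have ha' : 1 / a < 1 / 2 := one_div_lt_one_div_of_lt two_pos ha
  have hx0 : 0 < x := by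
    refine hx.lt_of_ne fun h => ?_
    rw [minimalPeriod_logistic_of_eq (by simp [logistic, ← h])] at hp
    exact lt_irrefl _ hp
  have hmem : x ∈ periodicPts (logistic a) := minimalPeriod_pos_iff_mem_periodicPts.1 (by omega)
  have hgrow : ∀ y, 0 < y → y < 1 / a → y < logistic a y := by
    intro y h₁ h₂
    have h : a * (1 - 1 / a - y) > 0 := mul_pos ha0 (by linarith)
    have e : logistic a y - y = y * (a * (1 - 1 / a - y)) := by
      unfold logistic
      field_simp
      ring
    have := mul_pos h₁ h
    linarith
  obtain ⟨m, hm⟩ : ∃ m, 1 / a ≤ (logistic a)^[m] x := by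
    by_contra! hcon
    have hpos : ∀ m, 0 < (logistic a)^[m] x := by
      intro m
      induction m with
      | zero => exact hx0
      | succ m ih =>
        rw [iterate_succ_apply']
        exact ih.trans (hgrow _ ih (hcon m))
    have hmono : StrictMono fun m => (logistic a)^[m] x := by
      refine strictMono_nat_of_lt_succ fun m => ?_
      rw [iterate_succ_apply']
      exact hgrow _ (hpos m) (hcon m)
    have := hmono (by omega : 0 < minimalPeriod (logistic a) x)
    simp at this
  have hm' : 1 / a ≤ (logistic a)^[m + minimalPeriod (logistic a) x] x := by simpa using hm
  obtain ⟨l, hl⟩ : ∃ l, m + minimalPeriod (logistic a) x = l + 1 :=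
    ⟨m + minimalPeriod (logistic a) x - 1, by omega⟩
  have hle : (logistic a)^[m + minimalPeriod (logistic a) x] x ≤ a / 4 := by
    rw [hl, iterate_succ_apply']
    exact logistic_le a _ ha0.le
  have hper := minimalPeriod_apply_iterate hmem (m + minimalPeriod (logistic a) x)
  have := not_odd_minimalPeriod_of_mem ha hj hm' hle (by rwa [hper])
  rwa [hper] at this

/-- Near the fixed point, on the right of the critical point, the second iterate has an inverse
branch contracting by a factor of two. -/
lemma exists_logistic_logistic_eq {a y : ℝ} (ha : 2 < a) (ha4 : a ≤ 4)
    (hj : 0 < a ^ 3 - 2 * a ^ 2 - 4 * a - 8) (hy : y ∈ Ico (1 / 2) (1 - 1 / a)) :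
    ∃ x ∈ Ico (1 / 2) (1 - 1 / a), logistic a (logistic a x) = y ∧
      2 * (1 - 1 / a - x) ≤ 1 - 1 / a - y := by
  have ha0 : 0 < a := by linarith
  have ha' : 1 / a < 1 / 2 := one_div_lt_one_div_of_lt two_pos ha
  have hexp : ∀ x ∈ Icc (1 / 2) (1 - 1 / a),
      2 * (1 - 1 / a - x) ≤ 1 - 1 / a - logistic a (logistic a x) := by
    intro x hx
    have hQ : a ^ 2 * x ^ 2 - a * (a + 1) * x + (a + 1) ≤ -(a ^ 2 - 2 * a - 4) / 4 := by
      have h₁ := mul_nonneg (sub_nonneg.2 hx.1) (sub_nonneg.2 hx.2)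
      have h₂ : 0 ≤ a * (4 - a) * (x - 1 / 2) :=
        mul_nonneg (mul_nonneg ha0.le (by linarith)) (sub_nonneg.2 hx.1)
      have h₃ : a ^ 2 * ((x - 1 / 2) * (1 - 1 / a - x))
          = a * ((x - 1 / 2) * (a - 1 - a * x)) := by
        field_simp
      have h₄ := mul_nonneg (sq_nonneg a) h₁
      rw [h₃] at h₄
      nlinarith
    have hM : 1 ≤ a * x * -(a ^ 2 * x ^ 2 - a * (a + 1) * x + (a + 1)) := by
      have h₁ : 8 < a * (a ^ 2 - 2 * a - 4) := by linarith
      have h₂ : 0 < a ^ 2 - 2 * a - 4 := by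
        by_contra! h
        nlinarith
      have h₃ : a / 2 ≤ a * x := by nlinarith [hx.1]
      calc (1 : ℝ) ≤ a / 2 * ((a ^ 2 - 2 * a - 4) / 4) := by linarith
        _ ≤ _ := mul_le_mul h₃ (by linarith) (by linarith) (by linarith)
    have e : 1 - 1 / a - logistic a (logistic a x) = (1 - 1 / a - x) *
        (1 + a * x * -(a ^ 2 * x ^ 2 - a * (a + 1) * x + (a + 1))) := by
      unfold logistic
      field_simp
      ring
    rw [e, mul_comm]
    exact mul_le_mul_of_nonneg_left (by linarith) (sub_nonneg.2 hx.2)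
  have hfix : logistic a (1 - 1 / a) = 1 - 1 / a := by
    unfold logistic
    field_simp
    ring
  have hhalf := hexp (1 / 2) ⟨le_rfl, by linarith⟩
  obtain ⟨x, hx, hxy⟩ := intermediate_value_Icc (by linarith : 1 / 2 ≤ 1 - 1 / a)
    ((continuous_logistic a).comp (continuous_logistic a)).continuousOn
    (show y ∈ Icc _ _ from ⟨by rw [comp_apply]; linarith [hy.1],
      by rw [comp_apply, hfix, hfix]; exact hy.2.le⟩)
  rw [comp_apply] at hxy
  refine ⟨x, ⟨hx.1, hx.2.lt_of_ne ?_⟩, hxy, hxy ▸ hexp x hx⟩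
  rintro rfl
  rw [hfix, hfix] at hxy
  exact hy.2.ne' hxy

lemma exists_iterate_logistic_eq_half {a : ℝ} (ha : 2 < a) (ha4 : a ≤ 4)
    (hj : 0 < a ^ 3 - 2 * a ^ 2 - 4 * a - 8) (n : ℕ) :
    ∃ x ∈ Ico (1 / 2) (1 - 1 / a), (logistic a)^[2 * n] x = 1 / 2 ∧
      1 - 1 / a - x ≤ (1 / 2) ^ n := by
  have ha' : 1 / a < 1 / 2 := one_div_lt_one_div_of_lt two_pos ha
  induction n with
  | zero =>
    have : 0 < 1 / a := by positivity
    exact ⟨1 / 2, ⟨le_rfl, by linarith⟩, rfl, by rw [pow_zero]; linarith⟩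
  | succ n ih =>
    obtain ⟨y, hy, hyn, hle⟩ := ih
    obtain ⟨x, hx, hxy, hle'⟩ := exists_logistic_logistic_eq ha ha4 hj hy
    refine ⟨x, hx, ?_, ?_⟩
    · rw [show 2 * (n + 1) = 2 * n + 1 + 1 by ring, iterate_succ_apply, iterate_succ_apply, hxy,
        hyn]
    · rw [pow_succ]
      linarith

lemma exists_odd_minimalPeriod {a : ℝ} (ha : 2 < a) (ha4 : a ≤ 4)
    (hj : 0 < a ^ 3 - 2 * a ^ 2 - 4 * a - 8) :
    ∃ x, 0 ≤ x ∧ x ≤ a / 4 ∧ 1 < minimalPeriod (logistic a) x ∧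
      Odd (minimalPeriod (logistic a) x) := by
  have ha0 : 0 < a := by linarith
  have ha' : 1 / a < 1 / 2 := one_div_lt_one_div_of_lt two_pos ha
  have hpa : 1 - 1 / a ≤ a / 4 := by
    have : a / 4 - (1 - 1 / a) = (a - 2) ^ 2 / (4 * a) := by
      field_simp
      ring
    have : 0 ≤ (a - 2) ^ 2 / (4 * a) := by positivity
    linarith
  have hhalf : logistic a (1 / 2) = a / 4 := by
    unfold logistic
    ring
  have hlt : logistic a (logistic a (a / 4)) < 1 - 1 / a := by
    have hu : logistic a (a / 4) < 1 / a := by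
      unfold logistic
      rw [lt_div_iff₀ ha0]
      nlinarith [mul_pos (by linarith : 0 < a - 2) hj]
    have e : ∀ u, 1 - 1 / a - logistic a u = a * ((1 / a - u) * (1 - 1 / a - u)) := by
      intro u
      unfold logistic
      field_simp
      ring
    have := e (logistic a (a / 4))
    have := mul_pos ha0 (mul_pos (sub_pos.2 hu)
      (by linarith : 0 < 1 - 1 / a - logistic a (a / 4)))
    linarith
  obtain ⟨n, hn⟩ := exists_pow_lt_of_lt_one (sub_pos.2 hlt) (by norm_num : (1 / 2 : ℝ) < 1)
  obtain ⟨x, hx, hxn, hle⟩ := exists_iterate_logistic_eq_half ha ha4 hj n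
  obtain ⟨y, hy, hyx, -⟩ := exists_logistic_logistic_eq ha ha4 hj hx
  have hxN : (logistic a)^[2 * n + 3] x ≤ x := by
    rw [add_comm, iterate_add_apply, hxn]
    change logistic a (logistic a (logistic a (1 / 2))) ≤ x
    rw [hhalf]
    linarith
  have hyN : y ≤ (logistic a)^[2 * n + 3] y := by
    rw [iterate_succ_apply', iterate_succ_apply, iterate_succ_apply, hyx, hxn, hhalf]
    exact hy.2.le.trans hpa
  obtain ⟨w, hw, hw0⟩ := (isPreconnected_Ico (a := (1 / 2 : ℝ)) (b := 1 - 1 / a)).intermediate_value₂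
    hx hy ((continuous_logistic a).iterate (2 * n + 3)).continuousOn continuousOn_id hxN hyN
  have hper : IsPeriodicPt (logistic a) (2 * n + 3) w := hw0
  have hodd : Odd (minimalPeriod (logistic a) w) :=
    Odd.of_dvd_nat ⟨n + 1, by ring⟩ hper.minimalPeriod_dvd
  refine ⟨w, by linarith [hw.1], by linarith [hw.2], ?_, hodd⟩
  have hne : minimalPeriod (logistic a) w ≠ 1 := fun h =>
    hw.2.ne (logistic_eq_self ha0 (minimalPeriod_eq_one_iff_isFixedPt.1 h)
      (by linarith [hw.1] : (0 : ℝ) < w).ne')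
  have := hodd.pos
  omega

lemma semiconj_logistic_f (β k δ : ℝ) (hk : k ≠ 0) (hδ : δ ≠ 0) :
    Semiconj (fun x => (β + δ) / (δ * k) * x) (logistic (β + δ)) (f β k δ) := by
  intro x
  unfold logistic f
  field_simp
  ring

lemma minimalPeriod_f (β k δ x : ℝ) (hk : k ≠ 0) (hδ : δ ≠ 0) (ha : β + δ ≠ 0) :
    minimalPeriod (f β k δ) ((β + δ) / (δ * k) * x) = minimalPeriod (logistic (β + δ)) x := by
  have hm : (β + δ) / (δ * k) ≠ 0 := div_ne_zero ha (mul_ne_zero hδ hk)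
  refine minimalPeriod_eq_minimalPeriod_iff.2 fun n => ?_
  have h : (β + δ) / (δ * k) * (logistic (β + δ))^[n] x
      = (f β k δ)^[n] ((β + δ) / (δ * k) * x) :=
    (semiconj_logistic_f β k δ hk hδ).iterate_right n x
  unfold IsPeriodicPt IsFixedPt
  rw [← h]
  exact mul_right_inj' hm

/-- `f` has an odd period cycle on `E = [0, 1/k]` iff `j(δ) > 0`. -/
theorem stmt_1 (β k δ : ℝ) (hβ0 : 0 < β) (hβ1 : β < 1) (hk : 0 < k) (hδ : 0 < δ)
    (hlow : max (2 - β) β < δ) (hhigh : δ ≤ 2 - β + 2 * Real.sqrt (1 - β)) :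
    (∃ Y ∈ Set.Icc 0 (1 / k), 1 < Function.minimalPeriod (f β k δ) Y ∧
      Odd (Function.minimalPeriod (f β k δ) Y)) ↔ 0 < j β δ := by
  have ha : 2 < β + δ := by linarith [le_max_left (2 - β) β]
  have hm : 0 < (β + δ) / (δ * k) := by positivity
  have hconj := fun x => minimalPeriod_f β k δ x hk.ne' hδ.ne' (by linarith)
  have hsq : (β + δ) ^ 2 ≤ 4 * δ := by
    nlinarith [Real.sq_sqrt (by linarith : 0 ≤ 1 - β), Real.sqrt_nonneg (1 - β)]
  have ha4 : β + δ ≤ 4 := by nlinarith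
  have hj : j β δ = (β + δ) ^ 3 - 2 * (β + δ) ^ 2 - 4 * (β + δ) - 8 := by
    unfold j
    ring
  rw [hj]
  constructor
  · rintro ⟨Y, hY, hp, hodd⟩
    have hYx : Y = (β + δ) / (δ * k) * (Y / ((β + δ) / (δ * k))) := by field_simp
    rw [hYx, hconj] at hp hodd
    by_contra! hneg
    exact not_odd_minimalPeriod ha (div_nonneg hY.1 hm.le) hneg hp hodd
  · intro hpos
    obtain ⟨x, hx0, hx1, hp, hodd⟩ := exists_odd_minimalPeriod ha ha4 hpos
    refine ⟨(β + δ) / (δ * k) * x, ⟨by positivity, ?_⟩, ?_, ?_⟩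
    · calc (β + δ) / (δ * k) * x ≤ (β + δ) / (δ * k) * ((β + δ) / 4) := by gcongr
        _ = (β + δ) ^ 2 / (4 * δ) * (1 / k) := by field_simp
        _ ≤ 1 * (1 / k) := by
          gcongr
          exact (div_le_one (by positivity)).2 hsq
        _ = 1 / k := one_mul _
    · rwa [hconj]
    · rwa [hconj]
end

section
/- If max{2−β, β} < δ ≤ 2−β+2√(1−β), then f(f(s)) < s if and only if 1 − β + √5 < δ. -/
open Set

/-- The map is conjugate to the logistic map with parameter `β + δ`, which makes the displacement
of the critical point under two iterations factor completely. -/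
theorem s_sub_f_f_s (β k δ : ℝ) (hk : k ≠ 0) (hδ : δ ≠ 0) :
    s β k δ - f β k δ (f β k δ (s β k δ)) =
      (β + δ) * (β + δ - 2) * (β + δ - 1 + Real.sqrt 5) / (16 * δ * k) *
        (δ - (1 - β + Real.sqrt 5)) := by
  have h5 : Real.sqrt 5 ^ 2 = 5 := Real.sq_sqrt (by norm_num)
  have hfactor : (β + δ - 1 + Real.sqrt 5) * (δ - (1 - β + Real.sqrt 5)) =
      (β + δ) ^ 2 - 2 * (β + δ) - 4 := by
    linear_combination -h5
  rw [div_mul_eq_mul_div, mul_assoc _ (β + δ - 1 + Real.sqrt 5), hfactor]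
  unfold f s
  field_simp
  ring

theorem stmt_3 (β k δ : ℝ) (hβ0 : 0 < β) (hβ1 : β < 1) (hk : 0 < k) (hδ : 0 < δ)
    (hlow : max (2 - β) β < δ) (hhigh : δ ≤ 2 - β + 2 * Real.sqrt (1 - β)) :
    f β k δ (f β k δ (s β k δ)) < s β k δ ↔ 1 - β + Real.sqrt 5 < δ := by
  have h2 : 0 < β + δ - 2 := by linarith [(max_lt_iff.mp hlow).1]
  have h5 : 0 < β + δ - 1 + Real.sqrt 5 := by linarith [Real.sqrt_nonneg 5]
  have hcoef : 0 < (β + δ) * (β + δ - 2) * (β + δ - 1 + Real.sqrt 5) / (16 * δ * k) := by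
    positivity
  rw [← sub_pos, s_sub_f_f_s β k δ hk.ne' hδ.ne', mul_pos_iff_of_pos_left hcoef, sub_pos]
end

section
/- If max{2−β, β} < δ ≤ 2−β+2√(1−β) and 1 − β + √5 < δ, then the set Π = {Y ∈ [s, 1/k] : f(Y) ∈ [s, 1/k] and f(f(Y)) = Y} equals the singleton {z}, where z = (δ+β−1)/(δk) is the unique nonzero fixed point of f. -/
open Set

/-- The nonzero fixed point `z = (δ + β − 1)/(δk)`. -/
noncomputable def z (β k δ : ℝ) : ℝ := (δ + β - 1) / (δ * k)

/-- The fixed points of `f` are `0` and `z`. -/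
theorem f_eq_self_iff {β k δ : ℝ} (hk : 0 < k) (hδ : 0 < δ) (Y : ℝ) :
    f β k δ Y = Y ↔ Y = 0 ∨ Y = z β k δ := by
  have hc : δ * k ≠ 0 := by positivity
  have h : f β k δ Y - Y = Y * (δ + β - 1 - Y * (δ * k)) := by
    simp only [f]
    ring
  rw [← sub_eq_zero, h, mul_eq_zero, sub_eq_zero, z, eq_div_iff hc, eq_comm (a := δ + β - 1)]

/-- A 2-cycle of `x ↦ a * x - x ^ 2` whose points both lie to the right of the critical point
`a / 2` is a fixed point when `1 + √5 < a`. -/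
theorem eq_of_two_cycle_right {a x y : ℝ} (ha : 1 + Real.sqrt 5 < a)
    (hx : a / 2 ≤ x) (hy : a / 2 ≤ y)
    (hxy : a * x - x ^ 2 = y) (hyx : a * y - y ^ 2 = x) : x = y := by
  by_contra hne
  have hsum : x + y = a + 1 := by
    apply mul_left_cancel₀ (sub_ne_zero.2 hne)
    linear_combination -hxy + hyx
  have hprod : x * y = a + 1 := by
    linear_combination (hxy + hyx) / 2 + (x + y + 2) / 2 * hsum
  have hnonneg := mul_nonneg (sub_nonneg.2 hx) (sub_nonneg.2 hy)
  have hident : (x - a / 2) * (y - a / 2) = (5 - (a - 1) ^ 2) / 4 := by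
    linear_combination hprod - a / 2 * hsum
  have hsq : 5 < (a - 1) ^ 2 := Real.lt_sq_of_sqrt_lt (by linarith)
  linarith

theorem stmt_4 (β k δ : ℝ) (hβ0 : 0 < β) (hβ1 : β < 1) (hk : 0 < k) (hδ : 0 < δ)
    (hlow : max (2 - β) β < δ) (hhigh : δ ≤ 2 - β + 2 * Real.sqrt (1 - β))
    (hLY : 1 - β + Real.sqrt 5 < δ) :
    {Y ∈ Set.Icc (s β k δ) (1 / k) |
        f β k δ Y ∈ Set.Icc (s β k δ) (1 / k) ∧ f β k δ (f β k δ Y) = Y}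
      = {z β k δ} ∧
    (∀ Y : ℝ, f β k δ Y = Y ↔ Y = 0 ∨ Y = z β k δ) := by
  refine ⟨?_, f_eq_self_iff hk hδ⟩
  have hc : 0 < δ * k := by positivity
  have ha : 1 + Real.sqrt 5 < β + δ := by linarith
  have ha2 : 2 < β + δ := by linarith [le_max_left (2 - β) β]
  have hs : ∀ Y, s β k δ ≤ Y → (β + δ) / 2 ≤ δ * k * Y := by
    intro Y hY
    rw [s, div_le_iff₀ (by positivity)] at hY
    linarith
  have hspos : 0 < s β k δ := by
    unfold s
    positivity
  ext Y
  simp only [mem_ofPred_eq, mem_singleton_iff]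
  constructor
  · rintro ⟨hY, hW, hcycle⟩
    have hfix : δ * k * Y = δ * k * f β k δ Y := by
      refine eq_of_two_cycle_right ha (hs _ hY.1) (hs _ hW.1) ?_ ?_
      · simp only [f]
        ring
      · conv_rhs => rw [← hcycle]
        generalize f β k δ Y = W
        simp only [f]
        ring
    have hfix' : f β k δ Y = Y := (mul_left_cancel₀ hc.ne' hfix).symm
    exact ((f_eq_self_iff hk hδ Y).1 hfix').resolve_left (hspos.trans_le hY.1).ne'
  · rintro rfl
    have hz : f β k δ (z β k δ) = z β k δ := (f_eq_self_iff hk hδ _).2 (Or.inr rfl)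
    have hmem : z β k δ ∈ Icc (s β k δ) (1 / k) := by
      constructor
      · rw [s, z, div_le_div_iff₀ (by positivity) hc]
        nlinarith
      · rw [z, div_le_div_iff₀ hc hk]
        nlinarith
    exact ⟨hmem, by rwa [hz], by rw [hz, hz]⟩
end

section
/- If max{2−β, β} < δ ≤ 2−β+2√(1−β), then f(f(f(s))) < z if and only if j(δ) > 0, and f(f(f(s))) ≤ z if and only if j(δ) ≥ 0, where j(δ) = δ³ + 3βδ² − 2δ² + 3β²δ − 4βδ − 4δ + β³ − 2β² − 4β − 8. -/
open Set

/-- The gap between the fixed point and the third iterate of the critical point is a positive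
multiple of `j`, once `2 < β + δ`. -/
theorem z_sub_f_f_f_s (β k δ : ℝ) (hk : k ≠ 0) (hδ : δ ≠ 0) :
    z β k δ - f β k δ (f β k δ (f β k δ (s β k δ))) =
      (β + δ - 2) ^ 4 * (β + δ + 2) / (256 * (δ * k)) * j β δ := by
  simp only [z, f, s, j]
  field_simp
  ring

theorem stmt_5 (β k δ : ℝ) (hβ0 : 0 < β) (hβ1 : β < 1) (hk : 0 < k) (hδ : 0 < δ)
    (hlow : max (2 - β) β < δ) (hhigh : δ ≤ 2 - β + 2 * Real.sqrt (1 - β)) :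
    (f β k δ (f β k δ (f β k δ (s β k δ))) < z β k δ ↔ 0 < j β δ) ∧
    (f β k δ (f β k δ (f β k δ (s β k δ))) ≤ z β k δ ↔ 0 ≤ j β δ) := by
  have ha : 0 < β + δ - 2 := by linarith [(max_lt_iff.mp hlow).1]
  have hc : 0 < (β + δ - 2) ^ 4 * (β + δ + 2) / (256 * (δ * k)) := by positivity
  have h := z_sub_f_f_f_s β k δ hk.ne' hδ.ne'
  constructor
  · rw [← sub_pos, h, mul_pos_iff_of_pos_left hc]
  · rw [← sub_nonneg, h, mul_nonneg_iff_of_pos_left hc]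
end

section
/- If 0 < β < 1, k > 0 and δ > 1 − β + √5, then D := δ² + 2βδ − 2δ + β² − 2β − 3 > 0 and the set of real solutions of f(f(Y)) = Y is exactly {0, z, (δ+β+1+√D)/(2δk), (δ+β+1−√D)/(2δk)}, where z = (δ+β−1)/(δk). -/
open Set

/-- The second-iterate fixed-point polynomial, fully factored with the help of a square root `s` of
its discriminant. -/
theorem four_mul_f_f_sub_self (β k δ s Y : ℝ)
    (hs : s ^ 2 = δ ^ 2 + 2 * β * δ - 2 * δ + β ^ 2 - 2 * β - 3) :
    4 * (f β k δ (f β k δ Y) - Y) =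
      -(Y * (Y * (δ * k) - (δ + β - 1)) * (Y * (2 * δ * k) - (δ + β + 1 + s)) *
        (Y * (2 * δ * k) - (δ + β + 1 - s))) := by
  simp only [f]
  linear_combination (-(Y * (Y * (δ * k) - (δ + β - 1)))) * hs

theorem stmt_7 (β k δ : ℝ) (hβ0 : 0 < β) (hβ1 : β < 1) (hk : 0 < k)
    (hδ : 1 - β + Real.sqrt 5 < δ) :
    0 < δ ^ 2 + 2 * β * δ - 2 * δ + β ^ 2 - 2 * β - 3 ∧
    {Y : ℝ | f β k δ (f β k δ Y) = Y}
      = {0, z β k δ,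
          (δ + β + 1 + Real.sqrt (δ ^ 2 + 2 * β * δ - 2 * δ + β ^ 2 - 2 * β - 3))
            / (2 * δ * k),
          (δ + β + 1 - Real.sqrt (δ ^ 2 + 2 * β * δ - 2 * δ + β ^ 2 - 2 * β - 3))
            / (2 * δ * k)} := by
  have h5 : (2 : ℝ) < √5 := Real.lt_sqrt_of_sq_lt (by norm_num)
  have hδ0 : 0 < δ := by linarith
  have hD : 0 < δ ^ 2 + 2 * β * δ - 2 * δ + β ^ 2 - 2 * β - 3 := by
    have : 0 < (δ + β - 3) * (δ + β + 1) := mul_pos (by linarith) (by linarith)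
    linarith
  refine ⟨hD, ?_⟩
  have hs := Real.sq_sqrt hD.le
  generalize √(δ ^ 2 + 2 * β * δ - 2 * δ + β ^ 2 - 2 * β - 3) = s at hs ⊢
  ext Y
  have h1 : δ * k ≠ 0 := by positivity
  have h2 : 2 * δ * k ≠ 0 := by positivity
  have key : f β k δ (f β k δ Y) = Y ↔ 4 * (f β k δ (f β k δ Y) - Y) = 0 := by
    simp [sub_eq_zero]
  rw [mem_ofPred_eq, key, four_mul_f_f_sub_self β k δ s Y hs]
  simp only [mem_insert_iff, mem_singleton_iff, z, eq_div_iff h1, eq_div_iff h2, neg_eq_zero,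
    mul_eq_zero, sub_eq_zero, or_assoc]
end

section
/- If β(1−kY₀)/k < μ ≤ (1−kY₀)/(k²Y₀), then: h is continuous on E; h maps E into E; h is strictly decreasing on [0, Y₀] and strictly increasing on [Y₀, 1/k]; h(0) > 0; h(1/k) ≤ 1/k; and h(Y) < Y for every Y ∈ [Y₀, 1/k). -/
open Set

/-- The piecewise linear macrodynamics map `h`. -/
noncomputable def h (β k μ Y₀ : ℝ) : ℝ → ℝ := fun Y =>
  if Y ≤ Y₀ then (β - μ * k / (1 - k * Y₀)) * Y + μ / (1 - k * Y₀) - μ else β * Y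

/-- The map `h` is the linear map `β * Y` plus a ramp supported on `Y ≤ Y₀`. -/
theorem h_eq_add_max {β k μ Y₀ : ℝ} (hd : 0 < 1 - k * Y₀) (Y : ℝ) :
    h β k μ Y₀ Y = β * Y + μ * k / (1 - k * Y₀) * max (Y₀ - Y) 0 := by
  unfold h
  split_ifs with hY
  · rw [max_eq_left (sub_nonneg.2 hY)]
    field_simp
    ring
  · rw [max_eq_right (by linarith)]
    ring

theorem stmt_10 (β k μ Y₀ : ℝ) (hβ0 : 0 < β) (hβ1 : β < 1) (hk : 0 < k) (hμ : 0 < μ)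
    (hY₀ : 0 < Y₀) (hY₀' : Y₀ < 1 / k)
    (hlow : β * (1 - k * Y₀) / k < μ) (hhigh : μ ≤ (1 - k * Y₀) / (k ^ 2 * Y₀)) :
    ContinuousOn (h β k μ Y₀) (Set.Icc 0 (1 / k)) ∧
    Set.MapsTo (h β k μ Y₀) (Set.Icc 0 (1 / k)) (Set.Icc 0 (1 / k)) ∧
    StrictAntiOn (h β k μ Y₀) (Set.Icc 0 Y₀) ∧
    StrictMonoOn (h β k μ Y₀) (Set.Icc Y₀ (1 / k)) ∧
    0 < h β k μ Y₀ 0 ∧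
    h β k μ Y₀ (1 / k) ≤ 1 / k ∧
    ∀ Y ∈ Set.Ico Y₀ (1 / k), h β k μ Y₀ Y < Y := by
  have hd : 0 < 1 - k * Y₀ := by
    rw [lt_div_iff₀ hk] at hY₀'
    linarith
  have heq := h_eq_add_max (β := β) (μ := μ) hd
  have hβc : β < μ * k / (1 - k * Y₀) := by
    rw [div_lt_iff₀ hk] at hlow
    rwa [lt_div_iff₀ hd]
  have hcY : μ * k / (1 - k * Y₀) * Y₀ ≤ 1 / k := by
    rw [le_div_iff₀ (by positivity)] at hhigh
    rw [div_mul_eq_mul_div, div_le_div_iff₀ hd hk]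
    linarith
  generalize μ * k / (1 - k * Y₀) = c at heq hβc hcY
  have hleft {Y : ℝ} (hY : Y ≤ Y₀) : h β k μ Y₀ Y = β * Y + c * (Y₀ - Y) := by
    rw [heq, max_eq_left (sub_nonneg.2 hY)]
  have hright {Y : ℝ} (hY : Y₀ ≤ Y) : h β k μ Y₀ Y = β * Y := by
    rw [heq, max_eq_right (sub_nonpos.2 hY), mul_zero, add_zero]
  have hlt {Y : ℝ} (hY : Y₀ ≤ Y) : h β k μ Y₀ Y < Y := by
    rw [hright hY]
    exact mul_lt_of_lt_one_left (hY₀.trans_le hY) hβ1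
  refine ⟨?_, ?_, ?_, ?_, ?_, (hlt hY₀'.le).le, fun Y hY => hlt hY.1⟩
  · rw [funext heq]
    fun_prop
  · rintro Y ⟨hY0, hY1⟩
    refine ⟨?_, ?_⟩
    · rw [heq]
      have := hβ0.trans hβc
      positivity
    · rcases le_total Y Y₀ with hY | hY
      · rw [hleft hY]
        nlinarith
      · exact (hlt hY).le.trans hY1
  · intro a ha b hb hab
    rw [hleft ha.2, hleft hb.2]
    nlinarith
  · intro a ha b hb hab
    rw [hright ha.1, hright hb.1]
    exact mul_lt_mul_of_pos_left hab hβ0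
  · rw [hleft hY₀.le, mul_zero, zero_add, sub_zero]
    exact mul_pos (hβ0.trans hβc) hY₀
end

section
/- If β(1−kY₀)/k < μ ≤ (1−kY₀)/(k²Y₀), then h(h(Y₀)) > Y₀ if and only if (1+β)(1−kY₀)/k < μ. -/
open Set

/-- The left branch of `h` takes the value `β * Y₀` at the breakpoint. -/
theorem h_breakpoint {β k μ Y₀ : ℝ} (hd : 1 - k * Y₀ ≠ 0) : h β k μ Y₀ Y₀ = β * Y₀ := by
  simp only [h, le_refl, if_true]
  field_simp
  ring

theorem h_h_breakpoint_sub {β k μ Y₀ : ℝ} (hβ1 : β < 1) (hY₀ : 0 < Y₀) (hd : 1 - k * Y₀ ≠ 0) :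
    h β k μ Y₀ (h β k μ Y₀ Y₀) - Y₀ =
      Y₀ * (1 - β) * (μ * k / (1 - k * Y₀) - (1 + β)) := by
  have hle : β * Y₀ ≤ Y₀ := mul_le_of_le_one_left hY₀.le hβ1.le
  rw [h_breakpoint hd]
  simp only [h, if_pos hle]
  field_simp
  ring

theorem stmt_11 (β k μ Y₀ : ℝ) (hβ0 : 0 < β) (hβ1 : β < 1) (hk : 0 < k) (hμ : 0 < μ)
    (hY₀ : 0 < Y₀) (hY₀' : Y₀ < 1 / k)
    (hlow : β * (1 - k * Y₀) / k < μ) (hhigh : μ ≤ (1 - k * Y₀) / (k ^ 2 * Y₀)) :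
    Y₀ < h β k μ Y₀ (h β k μ Y₀ Y₀) ↔ (1 + β) * (1 - k * Y₀) / k < μ := by
  have hd : 0 < 1 - k * Y₀ := by
    rw [lt_div_iff₀ hk] at hY₀'
    linarith
  rw [← sub_pos, h_h_breakpoint_sub hβ1 hY₀ hd.ne',
    mul_pos_iff_of_pos_left (mul_pos hY₀ (sub_pos.2 hβ1)), sub_pos, lt_div_iff₀ hd,
    div_lt_iff₀ hk]
end

section
/- If β(1−kY₀)/k < μ ≤ (1−kY₀)/(k²Y₀) and (1+β)(1−kY₀)/k < μ, then the set Π̃ = {Y ∈ [0, Y₀] : h(Y) ∈ [0, Y₀] and h(h(Y)) = Y} equals the singleton {z̃}, and z̃ is the unique fixed point of h in E. -/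
open Set

/-- The fixed point `z̃ = μY₀k/(Y₀βk − Y₀k − β + kμ + 1)`. -/
noncomputable def ztilde (β k μ Y₀ : ℝ) : ℝ :=
  μ * Y₀ * k / (Y₀ * β * k - Y₀ * k - β + k * μ + 1)

/-- On `(−∞, Y₀]` the map `h` is affine with fixed point `z̃`. -/
lemma h_eq_ztilde_add {β k μ Y₀ Y : ℝ} (ha : 1 - k * Y₀ ≠ 0)
    (hD : Y₀ * β * k - Y₀ * k - β + k * μ + 1 ≠ 0) (hY : Y ≤ Y₀) :
    h β k μ Y₀ Y =
      ztilde β k μ Y₀ + (β - μ * k / (1 - k * Y₀)) * (Y - ztilde β k μ Y₀) := by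
  have hz : ztilde β k μ Y₀ * (Y₀ * β * k - Y₀ * k - β + k * μ + 1) = μ * Y₀ * k :=
    div_mul_cancel₀ _ hD
  rw [h, if_pos hY]
  generalize ztilde β k μ Y₀ = z at hz ⊢
  field_simp
  linear_combination -hz

theorem stmt_12 (β k μ Y₀ : ℝ) (hβ0 : 0 < β) (hβ1 : β < 1) (hk : 0 < k) (hμ : 0 < μ)
    (hY₀ : 0 < Y₀) (hY₀' : Y₀ < 1 / k)
    (hlow : β * (1 - k * Y₀) / k < μ) (hhigh : μ ≤ (1 - k * Y₀) / (k ^ 2 * Y₀))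
    (hodd : (1 + β) * (1 - k * Y₀) / k < μ) :
    {Y ∈ Set.Icc 0 Y₀ |
        h β k μ Y₀ Y ∈ Set.Icc 0 Y₀ ∧ h β k μ Y₀ (h β k μ Y₀ Y) = Y}
      = {ztilde β k μ Y₀} ∧
    (∀ Y ∈ Set.Icc 0 (1 / k), h β k μ Y₀ Y = Y ↔ Y = ztilde β k μ Y₀) := by
  have ha : 0 < 1 - k * Y₀ := by
    rw [lt_div_iff₀ hk] at hY₀'
    linarith
  have hμk : 0 < μ * k := mul_pos hμ hk
  have hD_gt : μ * k < Y₀ * β * k - Y₀ * k - β + k * μ + 1 := by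
    nlinarith [mul_pos ha (sub_pos.2 hβ1)]
  have hD : 0 < Y₀ * β * k - Y₀ * k - β + k * μ + 1 := hμk.trans hD_gt
  have hslope : β - μ * k / (1 - k * Y₀) < -1 := by
    rw [div_lt_iff₀ hk] at hodd
    have := (lt_div_iff₀ ha).2 hodd
    linarith
  have hz0 : 0 ≤ ztilde β k μ Y₀ := by
    unfold ztilde
    positivity
  have hzY₀ : ztilde β k μ Y₀ ≤ Y₀ := by
    rw [ztilde, div_le_iff₀ hD]
    nlinarith
  have haff {Y : ℝ} (hY : Y ≤ Y₀) := h_eq_ztilde_add (Y := Y) ha.ne' hD.ne' hY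
  have hfix : h β k μ Y₀ (ztilde β k μ Y₀) = ztilde β k μ Y₀ := by simp [haff hzY₀]
  generalize ztilde β k μ Y₀ = z at *
  generalize β - μ * k / (1 - k * Y₀) = b at *
  refine ⟨Set.eq_singleton_iff_unique_mem.2 ⟨⟨⟨hz0, hzY₀⟩, ?_, ?_⟩, ?_⟩,
    fun Y _ => ⟨fun hY => ?_, ?_⟩⟩
  · rw [hfix]
    exact ⟨hz0, hzY₀⟩
  · rw [hfix, hfix]
  · rintro Y ⟨⟨-, hY⟩, ⟨-, hhY⟩, hper⟩
    rw [haff hhY, haff hY] at hper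
    have hb : b ^ 2 - 1 ≠ 0 := by nlinarith
    have : (b ^ 2 - 1) * (Y - z) = 0 := by linear_combination hper
    exact sub_eq_zero.1 ((mul_eq_zero.1 this).resolve_left hb)
  · rcases le_or_gt Y Y₀ with hle | hgt
    · rw [haff hle] at hY
      have : (b - 1) * (Y - z) = 0 := by linear_combination hY
      exact sub_eq_zero.1 ((mul_eq_zero.1 this).resolve_left (by linarith))
    · rw [h, if_neg hgt.not_ge] at hY
      nlinarith [mul_pos (hY₀.trans hgt) (sub_pos.2 hβ1)]
  · rintro rfl
    exact hfix
end

section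
/- If β(1−kY₀)/k < μ ≤ (1−kY₀)/(k²Y₀) and (1+β)(1−kY₀)/k < μ, then h(h(h(Y₀))) > z̃ if and only if μ > (1−kY₀)(1+2β²+√(4β²+1))/(2βk), and h(h(h(Y₀))) ≥ z̃ if and only if μ ≥ (1−kY₀)(1+2β²+√(4β²+1))/(2βk). -/
open Set

/-- If `μ k / (1 - k Y₀) > 1 + β`, the orbit of `Y₀` leaves `(-∞, Y₀]` exactly at its second iterate,
which determines the third iterate in closed form. -/
lemma h_iterate_three (β k μ Y₀ : ℝ) (hβ1 : β < 1) (hk : 0 < k) (hY₀ : 0 < Y₀)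
    (hY₀' : 0 < 1 - k * Y₀) (hodd : (1 + β) * (1 - k * Y₀) / k < μ) :
    h β k μ Y₀ (h β k μ Y₀ (h β k μ Y₀ Y₀)) =
      β * Y₀ * (β ^ 2 + μ * k / (1 - k * Y₀) * (1 - β)) := by
  have hm : 1 + β < μ * k / (1 - k * Y₀) := by
    rw [div_lt_iff₀ hk] at hodd
    rwa [lt_div_iff₀ hY₀']
  have hleft (Y : ℝ) (hY : Y ≤ Y₀) :
      h β k μ Y₀ Y = β * Y + μ * k / (1 - k * Y₀) * (Y₀ - Y) := by
    simp only [h, if_pos hY]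
    field_simp
    ring
  rw [hleft Y₀ le_rfl, sub_self, mul_zero, add_zero, hleft (β * Y₀) (by nlinarith)]
  have hright : ¬ β * (β * Y₀) + μ * k / (1 - k * Y₀) * (Y₀ - β * Y₀) ≤ Y₀ := by
    have := mul_pos (mul_pos hY₀ (sub_pos.2 hβ1)) (sub_pos.2 hm)
    rw [not_le]
    linarith
  simp only [h, if_neg hright]
  ring

theorem stmt_13 (β k μ Y₀ : ℝ) (hβ0 : 0 < β) (hβ1 : β < 1) (hk : 0 < k) (hμ : 0 < μ)
    (hY₀ : 0 < Y₀) (hY₀' : Y₀ < 1 / k)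
    (hlow : β * (1 - k * Y₀) / k < μ) (hhigh : μ ≤ (1 - k * Y₀) / (k ^ 2 * Y₀))
    (hodd : (1 + β) * (1 - k * Y₀) / k < μ) :
    (ztilde β k μ Y₀ < h β k μ Y₀ (h β k μ Y₀ (h β k μ Y₀ Y₀)) ↔
      (1 - k * Y₀) * (1 + 2 * β ^ 2 + Real.sqrt (4 * β ^ 2 + 1)) / (2 * β * k) < μ) ∧
    (ztilde β k μ Y₀ ≤ h β k μ Y₀ (h β k μ Y₀ (h β k μ Y₀ Y₀)) ↔
      (1 - k * Y₀) * (1 + 2 * β ^ 2 + Real.sqrt (4 * β ^ 2 + 1)) / (2 * β * k) ≤ μ) := by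
  have hd : 0 < 1 - k * Y₀ := by
    rw [lt_div_iff₀ hk] at hY₀'
    linarith
  rw [h_iterate_three β k μ Y₀ hβ1 hk hY₀ hd hodd]
  obtain ⟨m, rfl⟩ : ∃ m, μ = m * (1 - k * Y₀) / k :=
    ⟨μ * k / (1 - k * Y₀), by field_simp⟩
  have hm : 1 + β < m := by
    rw [div_lt_div_iff_of_pos_right hk] at hodd
    exact lt_of_mul_lt_mul_right hodd hd.le
  set s := Real.sqrt (4 * β ^ 2 + 1)
  have hs2 : s ^ 2 = 4 * β ^ 2 + 1 := Real.sq_sqrt (by positivity)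
  have hs1 : 1 < s := Real.lt_sqrt_of_sq_lt (by nlinarith)
  have hden : 0 < 1 - β + m := by linarith
  have hfac : 0 < 2 * β * m - (1 + 2 * β ^ 2) + s := by nlinarith
  have hz : ztilde β k (m * (1 - k * Y₀) / k) Y₀ = m * Y₀ / (1 - β + m) := by
    have : Y₀ * β * k - Y₀ * k - β + k * (m * (1 - k * Y₀) / k) + 1
        = (1 - k * Y₀) * (1 - β + m) := by
      field_simp
      ring
    rw [ztilde, this]
    field_simp
  have hmk : m * (1 - k * Y₀) / k * k / (1 - k * Y₀) = m := by field_simp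
  have hC : 0 < Y₀ * (1 - β) * k * (2 * β * m - (1 + 2 * β ^ 2) + s) /
      (2 * (1 - k * Y₀) * (1 - β + m)) := by
    have := sub_pos.2 hβ1
    positivity
  have key : β * Y₀ * (β ^ 2 + m * (1 - β)) - m * Y₀ / (1 - β + m) =
      Y₀ * (1 - β) * k * (2 * β * m - (1 + 2 * β ^ 2) + s) / (2 * (1 - k * Y₀) * (1 - β + m)) *
      (m * (1 - k * Y₀) / k - (1 - k * Y₀) * (1 + 2 * β ^ 2 + s) / (2 * β * k)) := by
    clear_value s
    generalize 1 - k * Y₀ = d at hd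
    field_simp
    linear_combination (1 - β) * hs2
  rw [hz, hmk]
  constructor
  · rw [← sub_pos, key, mul_pos_iff_of_pos_left hC, sub_pos]
  · rw [← sub_nonneg, key, mul_nonneg_iff_of_pos_left hC, sub_nonneg]
end

section
/- If β(1−kY₀)/k < μ ≤ (1−kY₀)/(k²Y₀), then h (viewed as a map of E = [0,1/k] to itself) has an odd period cycle if and only if both (1+β)(1−kY₀)/k < μ and (1−kY₀)(1+2β²+√(4β²+1))/(2βk) < μ. -/
open Set

/-- A continuous piecewise linear map with fixed point `z`, slope `-a` up to the turning point `c`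
and slope `β` through the origin beyond it. -/
structure IsVShaped (f : ℝ → ℝ) (a β c z : ℝ) : Prop where
  slope_pos : 0 < a
  beta_pos : 0 < β
  beta_lt_one : β < 1
  turn_pos : 0 < c
  left : ∀ y ≤ c, f y = z - a * (y - z)
  right : ∀ y, c < y → f y = β * y
  glue : z - a * (c - z) = β * c

namespace IsVShaped

variable {f : ℝ → ℝ} {a β c z : ℝ}

lemma fixed_lt_turn (hf : IsVShaped f a β c z) : z < c := by
  obtain ⟨ha, hβ, hβ1, hc, -, -, hg⟩ := hf
  by_contra! hzc
  nlinarith [mul_nonneg ha.le (sub_nonneg.2 hzc), mul_pos hc (sub_pos.2 hβ1)]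

lemma min_lt_fixed (hf : IsVShaped f a β c z) : β * c < z := by
  nlinarith [mul_pos hf.slope_pos (sub_pos.2 hf.fixed_lt_turn), hf.glue]

lemma fixed_pos (hf : IsVShaped f a β c z) : 0 < z :=
  (mul_pos hf.beta_pos hf.turn_pos).trans hf.min_lt_fixed

lemma map_fixed (hf : IsVShaped f a β c z) : f z = z := by
  rw [hf.left z hf.fixed_lt_turn.le]; ring

lemma min_le_map (hf : IsVShaped f a β c z) (y : ℝ) : β * c ≤ f y := by
  rcases le_or_gt y c with hy | hy
  · rw [hf.left y hy]
    nlinarith [mul_nonneg hf.slope_pos.le (sub_nonneg.2 hy), hf.glue]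
  · rw [hf.right y hy]
    exact mul_le_mul_of_nonneg_left hy.le hf.beta_pos.le

lemma map_le_max (hf : IsVShaped f a β c z) {y : ℝ} (hy : β * c ≤ y) :
    f y ≤ max (z + a * (z - β * c)) (β * y) := by
  rcases le_or_gt y c with hyc | hyc
  · rw [hf.left y hyc]
    refine le_max_of_le_left ?_
    nlinarith [mul_nonneg hf.slope_pos.le (sub_nonneg.2 hy)]
  · rw [hf.right y hyc]
    exact le_max_right _ _

lemma iterate_le_max (hf : IsVShaped f a β c z) {y : ℝ} (hy : β * c ≤ y) (n : ℕ) :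
    β * c ≤ f^[n] y ∧ f^[n] y ≤ max (z + a * (z - β * c)) (β ^ n * y) := by
  induction n with
  | zero => exact ⟨hy, by simp⟩
  | succ n ih =>
    rw [Function.iterate_succ_apply']
    refine ⟨hf.min_le_map _, (hf.map_le_max ih.1).trans (max_le (le_max_left _ _) ?_)⟩
    have hM : 0 ≤ z + a * (z - β * c) := by
      nlinarith [mul_pos hf.slope_pos (sub_pos.2 hf.min_lt_fixed), hf.fixed_pos]
    rcases le_max_iff.1 ih.2 with h1 | h1
    · refine le_max_of_le_left ?_
      nlinarith [mul_le_mul_of_nonneg_left h1 hf.beta_pos.le,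
        mul_nonneg hM (sub_pos.2 hf.beta_lt_one).le]
    · refine le_max_of_le_right ?_
      rw [pow_succ', mul_assoc]
      exact mul_le_mul_of_nonneg_left h1 hf.beta_pos.le

lemma mem_Icc_of_isPeriodicPt (hf : IsVShaped f a β c z) {y : ℝ} {n : ℕ} (hn : 0 < n)
    (hy : Function.IsPeriodicPt f n y) : y ∈ Icc (β * c) (z + a * (z - β * c)) := by
  have hlow : β * c ≤ y := by
    obtain ⟨m, rfl⟩ := Nat.exists_eq_succ_of_ne_zero hn.ne'
    rw [← hy.eq, Function.iterate_succ_apply']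
    exact hf.min_le_map _
  refine ⟨hlow, ?_⟩
  have hup := (hf.iterate_le_max hlow n).2
  rw [hy.eq] at hup
  rcases le_max_iff.1 hup with h1 | h1
  · exact h1
  · have hpow : β ^ n < 1 := pow_lt_one₀ hf.beta_pos.le hf.beta_lt_one hn.ne'
    have hpos : 0 < y := (mul_pos hf.beta_pos hf.turn_pos).trans_le hlow
    nlinarith

lemma eq_fixed_of_odd (hf : IsVShaped f a β c z)
    (hM : β * (z + a * (z - β * c)) ≤ z) {y : ℝ} {n : ℕ} (hn : Odd n)
    (hy : Function.IsPeriodicPt f n y) : y = z := by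
  have hAB : MapsTo f (Icc (β * c) z) (Icc z (z + a * (z - β * c))) := by
    rintro x ⟨h1, h2⟩
    rw [hf.left x (h2.trans hf.fixed_lt_turn.le)]
    constructor
    · nlinarith [mul_nonneg hf.slope_pos.le (sub_nonneg.2 h2)]
    · nlinarith [mul_nonneg hf.slope_pos.le (sub_nonneg.2 h1)]
  have hBA : MapsTo f (Icc z (z + a * (z - β * c))) (Icc (β * c) z) := by
    rintro x ⟨h1, h2⟩
    refine ⟨hf.min_le_map x, ?_⟩
    rcases le_or_gt x c with hx | hx
    · rw [hf.left x hx]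
      nlinarith [mul_nonneg hf.slope_pos.le (sub_nonneg.2 h1)]
    · rw [hf.right x hx]
      exact (mul_le_mul_of_nonneg_left h2 hf.beta_pos.le).trans hM
  obtain ⟨k, rfl⟩ := hn
  have hmem := hf.mem_Icc_of_isPeriodicPt (by lia) hy
  have hit : f ((f^[2])^[k] y) = y := by
    rw [← Function.iterate_mul, ← Function.iterate_succ_apply' f]
    exact hy
  rcases le_total y z with h1 | h1
  · have hAA : MapsTo f^[2] (Icc (β * c) z) (Icc (β * c) z) := hBA.comp hAB
    have h2 := hAB (hAA.iterate k ⟨hmem.1, h1⟩)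
    rw [hit] at h2
    exact le_antisymm h1 h2.1
  · have hBB : MapsTo f^[2] (Icc z (z + a * (z - β * c))) (Icc z (z + a * (z - β * c))) :=
      hAB.comp hBA
    have h2 := hBA (hBB.iterate k ⟨h1, hmem.2⟩)
    rw [hit] at h2
    exact le_antisymm h2.2 h1

lemma exists_odd_minimalPeriod (hf : IsVShaped f a β c z) (ha : 1 < a)
    (hM : z < β * (z + a * (z - β * c))) :
    ∃ y ∈ Icc 0 (z + a * (z - β * c)), 1 < Function.minimalPeriod f y ∧
      Odd (Function.minimalPeriod f y) := by
  have hz := hf.fixed_pos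
  have hzc := hf.fixed_lt_turn
  have hβ := hf.beta_pos
  have hmin := hf.min_lt_fixed
  set M := z + a * (z - β * c) with hMdef
  have hzM : z < M := by nlinarith [mul_pos hf.slope_pos (sub_pos.2 hmin)]
  have hMz : M - z = a ^ 2 * (c - z) := by
    have := hf.glue
    rw [hMdef, ← this]; ring
  obtain ⟨n, hn⟩ := pow_unbounded_of_one_lt ((M - z) / (β * M - z)) ha
  set A := a ^ (2 * (n + 1)) with hA
  have hA1 : 1 < A := one_lt_pow₀ ha (by lia)
  have hAn : (M - z) < A * (β * M - z) := by
    rw [← div_lt_iff₀ (by linarith)]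
    exact hn.trans_le (pow_le_pow_right₀ ha.le (by lia))
  have hβA : 0 < β * A - 1 := by
    have : 0 < M * (β * A - 1) := by nlinarith [mul_pos hz (sub_pos.2 hA1)]
    exact pos_of_mul_pos_right this (by linarith)
  obtain ⟨y, hy⟩ : ∃ y, y * (β * A - 1) = z * (A - 1) := ⟨_, div_mul_cancel₀ _ hβA.ne'⟩
  have hyM : y ≤ M := by
    refine le_of_mul_le_mul_right ?_ hβA
    rw [hy]; linarith
  have hcy : c < y := by
    refine lt_of_mul_lt_mul_right ?_ hβA.le
    rw [hy]
    nlinarith [mul_pos (sub_pos.2 hmin) (sub_pos.2 hA1),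
      mul_pos hf.turn_pos (sub_pos.2 hf.beta_lt_one)]
  have hret : A * (β * y - z) = y - z := by linarith
  have hd : 0 < β * y - z := by
    have : 0 < A * (β * y - z) := by rw [hret]; linarith
    exact pos_of_mul_pos_right this (by linarith)
  have hle : ∀ j < 2 * (n + 1), z + (-a) ^ j * (β * y - z) ≤ c := by
    intro j hj
    rcases Nat.even_or_odd j with he | ho
    · rw [he.neg_pow]
      have h1 : a ^ 2 * a ^ j ≤ A := by
        rw [← pow_add]
        refine pow_le_pow_right₀ ha.le ?_
        obtain ⟨i, rfl⟩ := he
        lia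
      have h2 : a ^ 2 * (a ^ j * (β * y - z)) ≤ a ^ 2 * (c - z) := by
        nlinarith [mul_le_mul_of_nonneg_right h1 hd.le]
      linarith [le_of_mul_le_mul_left h2 (by positivity)]
    · rw [ho.neg_pow]
      have := mul_pos (pow_pos hf.slope_pos j) hd
      linarith
  have hiter : ∀ j ≤ 2 * (n + 1), f^[j + 1] y = z + (-a) ^ j * (β * y - z) := by
    intro j
    induction j with
    | zero => intro _; simp [hf.right y hcy]
    | succ j ih =>
      intro hj
      rw [Function.iterate_succ_apply', ih (by lia), hf.left _ (hle j (by lia))]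
      ring
  have hper : Function.IsPeriodicPt f (2 * (n + 1) + 1) y := by
    change f^[2 * (n + 1) + 1] y = y
    rw [hiter _ le_rfl, (even_two_mul (n + 1)).neg_pow, ← hA, hret]
    ring
  have hmp : Function.minimalPeriod f y = 2 * (n + 1) + 1 := by
    refine le_antisymm (hper.minimalPeriod_le (by lia)) ?_
    by_contra! hlt
    have hpos := hper.minimalPeriod_pos (by lia)
    have heq : f^[Function.minimalPeriod f y] y = y := Function.iterate_minimalPeriod
    obtain ⟨j, hj⟩ := Nat.exists_eq_succ_of_ne_zero hpos.ne'
    rw [hj, Nat.succ_eq_add_one] at heq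
    rw [hiter j (by lia)] at heq
    linarith [hle j (by lia)]
  refine ⟨y, ⟨by linarith, hyM⟩, ?_, ?_⟩
  · lia
  · rw [hmp]; exact odd_two_mul_add_one _

lemma lt_third_iterate_iff (hf : IsVShaped f a β c z) :
    z < β * (z + a * (z - β * c)) ↔ a + β < β * a ^ 2 := by
  have hp : 0 < c * (1 - β) := mul_pos hf.turn_pos (sub_pos.2 hf.beta_lt_one)
  have hq : 0 < 1 + a := by linarith [hf.slope_pos]
  have hz : z * (1 + a) = (a + β) * c := by linarith [hf.glue]
  have key : (1 + a) * (β * (z + a * (z - β * c)) - z) = c * (1 - β) * (β * a ^ 2 - (a + β)) := by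
    linear_combination (β * (1 + a) - 1) * hz
  rw [← sub_pos, ← mul_pos_iff_of_pos_left hq, key, mul_pos_iff_of_pos_left hp, sub_pos]

theorem exists_odd_minimalPeriod_iff (hf : IsVShaped f a β c z) {B : ℝ}
    (hB : z + a * (z - β * c) ≤ B) :
    (∃ y ∈ Icc 0 B, 1 < Function.minimalPeriod f y ∧ Odd (Function.minimalPeriod f y)) ↔
      a + β < β * a ^ 2 := by
  rw [← hf.lt_third_iterate_iff]
  constructor
  · rintro ⟨y, -, h1, h2⟩
    by_contra! hM
    have hy := hf.eq_fixed_of_odd hM h2 (Function.isPeriodicPt_minimalPeriod f y)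
    rw [hy, Function.minimalPeriod_eq_one_iff_isFixedPt.2 hf.map_fixed] at h1
    exact lt_irrefl _ h1
  · intro hM
    have hcond := hf.lt_third_iterate_iff.1 hM
    have ha : 1 < a := by
      by_contra! ha
      nlinarith [hf.slope_pos, hf.beta_pos, hf.beta_lt_one,
        mul_nonneg hf.beta_pos.le (mul_nonneg hf.slope_pos.le (sub_nonneg.2 ha))]
    obtain ⟨y, hy, h⟩ := hf.exists_odd_minimalPeriod ha hM
    exact ⟨y, ⟨hy.1, hy.2.trans hB⟩, h⟩

end IsVShaped

lemma add_lt_mul_sq_iff {a β : ℝ} (ha : 0 < a) (hβ : 0 < β) :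
    a + β < β * a ^ 2 ↔ 1 + Real.sqrt (4 * β ^ 2 + 1) < 2 * β * a := by
  rw [← lt_sub_iff_add_lt']
  constructor
  · intro h
    have h1 : 1 < β * a := by
      have : a * 1 < a * (β * a) := by linarith
      exact lt_of_mul_lt_mul_left this ha.le
    rw [← lt_sub_iff_add_lt', Real.sqrt_lt' (by linarith)]
    nlinarith [mul_lt_mul_of_pos_left h hβ]
  · intro h
    rw [← lt_sub_iff_add_lt'] at h
    have h1 := (Real.sqrt_lt' ((Real.sqrt_nonneg _).trans_lt h)).1 h
    refine lt_of_mul_lt_mul_left ?_ hβ.le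
    linarith

/-- `h` has an odd period cycle on `E = [0, 1/k]` iff both lower bounds on `μ` hold. -/
theorem stmt_14 (β k μ Y₀ : ℝ) (hβ0 : 0 < β) (hβ1 : β < 1) (hk : 0 < k) (hμ : 0 < μ)
    (hY₀ : 0 < Y₀) (hY₀' : Y₀ < 1 / k)
    (hlow : β * (1 - k * Y₀) / k < μ) (hhigh : μ ≤ (1 - k * Y₀) / (k ^ 2 * Y₀)) :
    (∃ Y ∈ Set.Icc 0 (1 / k), 1 < Function.minimalPeriod (h β k μ Y₀) Y ∧
        Odd (Function.minimalPeriod (h β k μ Y₀) Y)) ↔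
      ((1 + β) * (1 - k * Y₀) / k < μ ∧
        (1 - k * Y₀) * (1 + 2 * β ^ 2 + Real.sqrt (4 * β ^ 2 + 1)) / (2 * β * k) < μ) := by
  have hD : 0 < 1 - k * Y₀ := by
    rw [lt_div_iff₀ hk] at hY₀'
    linarith
  obtain ⟨m, hm⟩ : ∃ m, m = μ * k / (1 - k * Y₀) := ⟨_, rfl⟩
  have hmD : μ * k = m * (1 - k * Y₀) := by rw [hm, div_mul_cancel₀ _ hD.ne']
  have hμD : μ / (1 - k * Y₀) - μ = m * Y₀ := by
    rw [hm]; field_simp; ring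
  have bound_iff : ∀ t : ℝ, t * (1 - k * Y₀) / k < μ ↔ t < m := by
    intro t
    rw [div_lt_iff₀ hk, hmD, mul_lt_mul_iff_left₀ hD]
  have ha : 0 < m - β := sub_pos.2 ((bound_iff β).1 hlow)
  have hs : 0 < 1 + (m - β) := by linarith
  have hf : IsVShaped (h β k μ Y₀) (m - β) β Y₀ (m * Y₀ / (1 + (m - β))) := by
    refine ⟨ha, hβ0, hβ1, hY₀, ?_, ?_, ?_⟩
    · intro y hy
      simp only [h, if_pos hy]
      rw [add_sub_assoc, hμD, ← hm]
      field_simp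
      ring
    · intro y hy
      simp only [h, if_neg (not_le.2 hy)]
    · field_simp
      ring
  have hB : m * Y₀ / (1 + (m - β)) + (m - β) * (m * Y₀ / (1 + (m - β)) - β * Y₀) ≤ 1 / k := by
    have h1 : m * Y₀ / (1 + (m - β)) + (m - β) * (m * Y₀ / (1 + (m - β)) - β * Y₀)
        = m * Y₀ - (m - β) * (β * Y₀) := by
      field_simp
      ring
    have h2 : m * Y₀ ≤ 1 / k := by
      rw [le_div_iff₀ (by positivity)] at hhigh
      rw [le_div_iff₀ hk]
      refine le_of_mul_le_mul_right ?_ hD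
      linear_combination hhigh - Y₀ * k * hmD
    rw [h1]
    linarith [mul_pos ha (mul_pos hβ0 hY₀)]
  rw [hf.exists_odd_minimalPeriod_iff hB, add_lt_mul_sq_iff ha hβ0]
  have hsqrt : (1 - k * Y₀) * (1 + 2 * β ^ 2 + Real.sqrt (4 * β ^ 2 + 1)) / (2 * β * k)
      = (1 + 2 * β ^ 2 + Real.sqrt (4 * β ^ 2 + 1)) / (2 * β) * (1 - k * Y₀) / k := by
    field_simp
  rw [hsqrt, bound_iff, bound_iff, div_lt_iff₀ (by positivity)]
  constructor
  · intro hlt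
    refine ⟨?_, by linarith⟩
    have h1 : 1 ≤ Real.sqrt (4 * β ^ 2 + 1) := Real.one_le_sqrt.2 (by nlinarith)
    have h2 : β * 1 < β * (m - β) := by linarith
    linarith [lt_of_mul_lt_mul_left h2 hβ0.le]
  · rintro ⟨-, hlt⟩
    linarith
end

section
/- If β(1−kY₀)/k < μ ≤ (1−kY₀)/(k²Y₀), then the second iterate h² (viewed as a map of E = [0,1/k] to itself) is turbulent if and only if both (1+β)(1−kY₀)/k < μ and (1−kY₀)(1+2β²+√(4β²+1))/(2βk) ≤ μ. -/
open Set

/-- A map `g` is turbulent on `E` if there are `x₁, x₂, x₃ ∈ E` with `g x₁ = x₁`,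
`g x₂ = x₁`, `g x₃ = x₂` and either `x₁ < x₃ < x₂` or `x₂ < x₃ < x₁`. -/
def Turbulent (g : ℝ → ℝ) (E : Set ℝ) : Prop :=
  ∃ x₁ ∈ E, ∃ x₂ ∈ E, ∃ x₃ ∈ E,
    g x₁ = x₁ ∧ g x₂ = x₁ ∧ g x₃ = x₂ ∧
    ((x₁ < x₃ ∧ x₃ < x₂) ∨ (x₂ < x₃ ∧ x₃ < x₁))

/-- The map `h` in the coordinate `y = Y / Y₀`, with `-s` the slope of its decreasing branch. -/
noncomputable def normalizedMap (β s : ℝ) : ℝ → ℝ := fun y =>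
  if y ≤ 1 then s + β - s * y else β * y

section NormalizedMap

variable {β s : ℝ}

theorem normalizedMap_of_le {y : ℝ} (hy : y ≤ 1) : normalizedMap β s y = s + β - s * y :=
  if_pos hy

theorem normalizedMap_of_ge {y : ℝ} (hy : 1 ≤ y) : normalizedMap β s y = β * y := by
  rcases hy.eq_or_lt with rfl | hy
  · rw [normalizedMap_of_le le_rfl]; ring
  · exact if_neg hy.not_ge

theorem le_normalizedMap (hβ0 : 0 < β) (hs : 0 < s) (y : ℝ) : β ≤ normalizedMap β s y := by
  rcases le_total y 1 with hy | hy
  · rw [normalizedMap_of_le hy]; nlinarith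
  · rw [normalizedMap_of_ge hy]; nlinarith

/-- The four affine branches of the second iterate. -/
theorem normalizedMap_sq_cases (y : ℝ) :
    (y ≤ 1 ∧ s * y ≤ s + β - 1 ∧
      normalizedMap β s (normalizedMap β s y) = β * (s + β - s * y)) ∨
    (y ≤ 1 ∧ s + β - 1 ≤ s * y ∧
      normalizedMap β s (normalizedMap β s y) = s + β - s * (s + β - s * y)) ∨
    (1 ≤ y ∧ β * y ≤ 1 ∧
      normalizedMap β s (normalizedMap β s y) = s + β - s * (β * y)) ∨
    (1 ≤ y ∧ 1 ≤ β * y ∧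
      normalizedMap β s (normalizedMap β s y) = β * (β * y)) := by
  rcases le_total y 1 with hy | hy
  · rw [normalizedMap_of_le hy]
    rcases le_total (s * y) (s + β - 1) with h1 | h1
    · exact Or.inl ⟨hy, h1, normalizedMap_of_ge (by linarith)⟩
    · exact Or.inr (Or.inl ⟨hy, h1, normalizedMap_of_le (by linarith)⟩)
  · rw [normalizedMap_of_ge hy]
    rcases le_total (β * y) 1 with h1 | h1
    · exact Or.inr (Or.inr (Or.inl ⟨hy, h1, normalizedMap_of_le h1⟩))
    · exact Or.inr (Or.inr (Or.inr ⟨hy, h1, normalizedMap_of_ge h1⟩))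

variable {z : ℝ}

theorem fixed_lt_one (hβ1 : β < 1) (hs : 0 < s) (hz : z * (1 + s) = s + β) : z < 1 := by
  nlinarith

theorem sq_fixed_below (hβ0 : 0 < β) (hβ1 : β < 1) (hs : 0 < s) (hz : z * (1 + s) = s + β)
    {x : ℝ} (hx : normalizedMap β s (normalizedMap β s x) = x) (hxz : x < z) :
    s = 1 ∨ (1 ≤ s ∧ s * x ≤ s + β - 1) := by
  have hz1 := fixed_lt_one hβ1 hs hz
  have hxβ : β ≤ x := hx ▸ le_normalizedMap hβ0 hs _
  rcases normalizedMap_sq_cases (β := β) (s := s) x with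
    ⟨h1, h2, h3⟩ | ⟨h1, h2, h3⟩ | ⟨h1, h2, h3⟩ | ⟨h1, h2, h3⟩
  · right
    refine ⟨?_, h2⟩
    have : 0 ≤ (s - 1) * (1 - β) := by nlinarith [mul_le_mul_of_nonneg_left hxβ hs.le]
    nlinarith
  · left
    have h4 : (s - 1) * ((s + 1) * (x - z)) = 0 := by
      linear_combination hx - h3 - (s - 1) * hz
    rcases mul_eq_zero.1 h4 with h5 | h5
    · linarith
    · nlinarith
  · linarith
  · linarith

theorem sq_fixed_above (hβ0 : 0 < β) (hβ1 : β < 1) (hs : 0 < s) (hz : z * (1 + s) = s + β)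
    {x : ℝ} (hx : normalizedMap β s (normalizedMap β s x) = x) (hzx : z < x) :
    (s = 1 ∧ x ≤ 1) ∨ (1 ≤ s ∧ 1 ≤ x ∧ s + β - s * (β * x) = x) := by
  have hz1 := fixed_lt_one hβ1 hs hz
  rcases normalizedMap_sq_cases (β := β) (s := s) x with
    ⟨h1, h2, h3⟩ | ⟨h1, h2, h3⟩ | ⟨h1, h2, h3⟩ | ⟨h1, h2, h3⟩
  · exfalso
    nlinarith
  · left
    refine ⟨?_, h1⟩
    have h4 : (s - 1) * ((s + 1) * (x - z)) = 0 := by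
      linear_combination hx - h3 - (s - 1) * hz
    rcases mul_eq_zero.1 h4 with h5 | h5
    · linarith
    · nlinarith
  · right
    refine ⟨?_, h1, by linarith⟩
    have : 0 ≤ (s - 1) * (1 - β) := by nlinarith [mul_pos hs hβ0]
    nlinarith
  · exfalso
    nlinarith

theorem sq_le_self_of_fixed_below (hβ0 : 0 < β) (hβ1 : β < 1) (hs : 0 < s)
    (hz : z * (1 + s) = s + β) {x₁ x : ℝ}
    (hx₁ : normalizedMap β s (normalizedMap β s x₁) = x₁) (h₁x : x₁ ≤ x) (hxz : x ≤ z)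
    (h₁z : x₁ < z) : normalizedMap β s (normalizedMap β s x) ≤ x := by
  have hz1 := fixed_lt_one hβ1 hs hz
  have h₁β : β ≤ x₁ := hx₁ ▸ le_normalizedMap hβ0 hs _
  rcases normalizedMap_sq_cases (β := β) (s := s) x with
    ⟨h1, h2, h3⟩ | ⟨h1, h2, h3⟩ | ⟨h1, h2, h3⟩ | ⟨h1, h2, h3⟩
  · have h4 : normalizedMap β s (normalizedMap β s x₁) = β * (s + β - s * x₁) := by
      have h5 : s * x₁ ≤ s * x := mul_le_mul_of_nonneg_left h₁x hs.le
      rw [normalizedMap_of_le (by linarith : x₁ ≤ 1), normalizedMap_of_ge (by linarith)]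
    nlinarith [mul_nonneg (mul_pos hβ0 hs).le (sub_nonneg.2 h₁x)]
  · have hs1 : 1 ≤ s := by
      rcases sq_fixed_below hβ0 hβ1 hs hz hx₁ h₁z with h | h
      · exact h.ge
      · exact h.1
    have h4 : 0 ≤ (s - 1) * ((s + 1) * (z - x)) :=
      mul_nonneg (by linarith) (mul_nonneg (by linarith) (by linarith))
    have h5 : x - normalizedMap β s (normalizedMap β s x) = (s - 1) * ((s + 1) * (z - x)) := by
      linear_combination -h3 - (s - 1) * hz
    linarith
  · linarith
  · linarith

theorem self_le_sq_of_fixed_below (hβ0 : 0 < β) (hβ1 : β < 1) (hs : 0 < s)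
    (hz : z * (1 + s) = s + β) {x₁ x : ℝ}
    (hx₁ : normalizedMap β s (normalizedMap β s x₁) = x₁) (hx₁' : x ≤ x₁)
    (h₁z : x₁ < z) : x ≤ normalizedMap β s (normalizedMap β s x) := by
  have hz1 := fixed_lt_one hβ1 hs hz
  have hx1 : x ≤ 1 := by linarith
  rcases sq_fixed_below hβ0 hβ1 hs hz hx₁ h₁z with rfl | ⟨hs1, h2⟩
  · rcases normalizedMap_sq_cases (β := β) (s := 1) x with
      ⟨h1, h2, h3⟩ | ⟨h1, h2, h3⟩ | ⟨h1, h2, h3⟩ | ⟨h1, h2, h3⟩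
    · nlinarith
    · linarith
    · linarith
    · linarith
  · have h5 : s * x ≤ s * x₁ := mul_le_mul_of_nonneg_left hx₁' hs.le
    rw [normalizedMap_of_le (by linarith : x₁ ≤ 1), normalizedMap_of_ge (by linarith)] at hx₁
    rw [normalizedMap_of_le hx1, normalizedMap_of_ge (by linarith)]
    nlinarith

theorem sq_le_self_of_fixed_above (hβ0 : 0 < β) (hβ1 : β < 1) (hs : 0 < s)
    (hz : z * (1 + s) = s + β) {x₁ x : ℝ}
    (hx₁ : normalizedMap β s (normalizedMap β s x₁) = x₁) (h₁x : x₁ ≤ x)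
    (hz₁ : z < x₁) : normalizedMap β s (normalizedMap β s x) ≤ x := by
  have hz1 := fixed_lt_one hβ1 hs hz
  have hz0 : 0 < z := by nlinarith
  have hfix := sq_fixed_above hβ0 hβ1 hs hz hx₁ hz₁
  rcases normalizedMap_sq_cases (β := β) (s := s) x with
    ⟨h1, h2, h3⟩ | ⟨h1, h2, h3⟩ | ⟨h1, h2, h3⟩ | ⟨h1, h2, h3⟩
  · exfalso
    nlinarith
  · rcases hfix with ⟨rfl, -⟩ | ⟨-, h4, h5⟩
    · linarith
    · obtain rfl : x₁ = x := by linarith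
      exact hx₁.le
  · rcases hfix with ⟨rfl, -⟩ | ⟨-, h4, h5⟩
    · nlinarith
    · nlinarith [mul_nonneg (mul_pos hs hβ0).le (sub_nonneg.2 h₁x)]
  · rw [h3]
    nlinarith

theorem self_le_sq_of_fixed_above (hβ0 : 0 < β) (hβ1 : β < 1) (hs : 0 < s)
    (hz : z * (1 + s) = s + β) {x₁ x : ℝ}
    (hx₁ : normalizedMap β s (normalizedMap β s x₁) = x₁) (hzx : z < x) (hx₁' : x ≤ x₁) :
    x ≤ normalizedMap β s (normalizedMap β s x) := by
  have hz1 := fixed_lt_one hβ1 hs hz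
  have hfix := sq_fixed_above hβ0 hβ1 hs hz hx₁ (hzx.trans_le hx₁')
  rcases normalizedMap_sq_cases (β := β) (s := s) x with
    ⟨h1, h2, h3⟩ | ⟨h1, h2, h3⟩ | ⟨h1, h2, h3⟩ | ⟨h1, h2, h3⟩
  · exfalso
    nlinarith
  · have hs1 : 1 ≤ s := by
      rcases hfix with h | h
      · exact h.1.ge
      · exact h.1
    have h4 : 0 ≤ (s - 1) * ((s + 1) * (x - z)) :=
      mul_nonneg (by linarith) (mul_nonneg (by linarith) (by linarith))
    have h5 : normalizedMap β s (normalizedMap β s x) - x = (s - 1) * ((s + 1) * (x - z)) := by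
      linear_combination h3 + (s - 1) * hz
    linarith
  · rcases hfix with ⟨rfl, h4⟩ | ⟨-, h4, h5⟩
    · obtain rfl : x = 1 := by linarith
      linarith
    · nlinarith [mul_nonneg (mul_pos hs hβ0).le (sub_nonneg.2 hx₁')]
  · exfalso
    rcases hfix with ⟨rfl, h4⟩ | ⟨-, h4, h5⟩
    · nlinarith
    · have h6 : β * x ≤ β * x₁ := mul_le_mul_of_nonneg_left hx₁' hβ0.le
      nlinarith

theorem lt_sq_of_mul_lt (hβ1 : β < 1) (hs : 0 < s)
    (hz : z * (1 + s) = s + β) {x : ℝ} (hzx : z < x) (hxz : β * x < z) :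
    z < normalizedMap β s (normalizedMap β s x) := by
  have hz1 := fixed_lt_one hβ1 hs hz
  rcases normalizedMap_sq_cases (β := β) (s := s) x with
    ⟨h1, h2, h3⟩ | ⟨h1, h2, h3⟩ | ⟨h1, h2, h3⟩ | ⟨h1, h2, h3⟩
  · exfalso
    nlinarith
  · have h4 : normalizedMap β s (normalizedMap β s x) - z = s * (s * (x - z)) := by
      linear_combination h3 + (s - 1) * hz
    have h5 : 0 < s * (s * (x - z)) := mul_pos hs (mul_pos hs (by linarith))
    linarith
  · nlinarith
  · linarith

theorem sq_lt_of_le (hβ0 : 0 < β) (hβ1 : β < 1) (hs : 0 < s) (hz : z * (1 + s) = s + β)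
    (hm : β * (s + β - s * β) < z) {x : ℝ} (hβx : β ≤ x) (hxz : x < z) :
    normalizedMap β s (normalizedMap β s x) < z := by
  have hz1 := fixed_lt_one hβ1 hs hz
  rcases normalizedMap_sq_cases (β := β) (s := s) x with
    ⟨h1, h2, h3⟩ | ⟨h1, h2, h3⟩ | ⟨h1, h2, h3⟩ | ⟨h1, h2, h3⟩
  · nlinarith [mul_nonneg (mul_pos hβ0 hs).le (sub_nonneg.2 hβx)]
  · have h4 : z - normalizedMap β s (normalizedMap β s x) = s * (s * (z - x)) := by
      linear_combination -h3 - (s - 1) * hz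
    have h5 : 0 < s * (s * (z - x)) := mul_pos hs (mul_pos hs (by linarith))
    linarith
  · linarith
  · linarith

theorem sq_le_of_lt_sq (hβ0 : 0 < β) (hβ1 : β < 1) (hs : 0 < s) {x : ℝ} (hβx : β ≤ x)
    (hx : x < normalizedMap β s (normalizedMap β s x)) :
    normalizedMap β s (normalizedMap β s x) ≤ s + β - s * β := by
  have hm : 0 < s + β - s * β := by nlinarith
  rcases le_total (normalizedMap β s x) 1 with h1 | h1
  · rw [normalizedMap_of_le h1]
    nlinarith [le_normalizedMap hβ0 hs x]
  · rw [normalizedMap_of_ge h1] at hx ⊢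
    rcases le_total x 1 with h2 | h2
    · rw [normalizedMap_of_le h2]
      nlinarith [mul_nonneg (mul_pos hβ0 hs).le (sub_nonneg.2 hβx)]
    · exfalso
      rw [normalizedMap_of_ge h2] at hx
      have h3 : β * x ≤ x := mul_le_of_le_one_left (by linarith) hβ1.le
      have h4 : β * (β * x) ≤ β * x := mul_le_of_le_one_left (by positivity) hβ1.le
      linarith

theorem turbulent_normalizedMap_sq_iff (hβ0 : 0 < β) (hβ1 : β < 1) (hs : 0 < s) {M : ℝ}
    (hM : s + β ≤ M) :
    Turbulent (normalizedMap β s ∘ normalizedMap β s) (Icc 0 M) ↔ s + β ≤ β * s ^ 2 := by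
  obtain ⟨z, hz⟩ : ∃ z : ℝ, z * (1 + s) = s + β :=
    ⟨(s + β) / (1 + s), div_mul_cancel₀ _ (by positivity)⟩
  have hz1 := fixed_lt_one hβ1 hs hz
  have hz0 : 0 < z := by nlinarith
  have hβz : β < z := by nlinarith
  have key : (β * (s + β - s * β) - z) * (1 + s) = (1 - β) * (β * s ^ 2 - (s + β)) := by
    linear_combination -hz
  constructor
  · rintro ⟨x₁, -, x₂, -, x₃, -, e₁, e₂, e₃, H⟩
    simp only [Function.comp_apply] at e₁ e₂ e₃
    by_contra! hC
    have hm : β * (s + β - s * β) < z := by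
      have : (1 - β) * (β * s ^ 2 - (s + β)) < 0 :=
        mul_neg_of_pos_of_neg (by linarith) (by linarith)
      nlinarith
    have b₁ : β ≤ x₁ := e₁ ▸ le_normalizedMap hβ0 hs _
    have b₂ : β ≤ x₂ := e₃ ▸ le_normalizedMap hβ0 hs _
    rcases H with ⟨h13, h32⟩ | ⟨h23, h31⟩
    · have h2m : x₂ ≤ s + β - s * β :=
        e₃ ▸ sq_le_of_lt_sq hβ0 hβ1 hs (by linarith : β ≤ x₃) (by linarith)
      have h2z : β * x₂ < z := (mul_le_mul_of_nonneg_left h2m hβ0.le).trans_lt hm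
      rcases le_or_gt x₂ z with hc | hc
      · have := sq_le_self_of_fixed_below hβ0 hβ1 hs hz e₁ h13.le (by linarith) (by linarith)
        linarith
      · have h1z := lt_sq_of_mul_lt hβ1 hs hz hc h2z
        have := sq_le_self_of_fixed_above hβ0 hβ1 hs hz e₁ h13.le (by linarith)
        linarith
    · rcases lt_or_ge x₂ z with hc | hc
      · have h1z := sq_lt_of_le hβ0 hβ1 hs hz hm b₂ hc
        have := self_le_sq_of_fixed_below hβ0 hβ1 hs hz e₁ h31.le (by linarith)
        linarith
      · have := self_le_sq_of_fixed_above hβ0 hβ1 hs hz e₁ (by linarith) h31.le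
        linarith
  · intro hC
    have hm : z ≤ β * (s + β - s * β) := by
      have : 0 ≤ (1 - β) * (β * s ^ 2 - (s + β)) := mul_nonneg (by linarith) (by linarith)
      nlinarith
    obtain ⟨w, hw⟩ : ∃ w : ℝ, β * w = z := ⟨z / β, mul_div_cancel₀ _ hβ0.ne'⟩
    obtain ⟨v, hv⟩ : ∃ v : ℝ, s * v = s + β - w :=
      ⟨(s + β - w) / s, mul_div_cancel₀ _ hs.ne'⟩
    obtain ⟨x, hx⟩ : ∃ x : ℝ, s * x = s + β - v :=
      ⟨(s + β - v) / s, mul_div_cancel₀ _ hs.ne'⟩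
    have hwm : w ≤ s + β - s * β := by nlinarith
    have hw1 : 1 ≤ w := by nlinarith
    have hvβ : β ≤ v := by nlinarith
    have hvz : v < z := by nlinarith
    have hx1 : x ≤ 1 := by nlinarith
    have hzx : z < x := by nlinarith
    have hxw : x < w := by
      rcases hw1.eq_or_lt with h1 | h1
      · subst h1
        linarith
      · linarith
    have fz : normalizedMap β s z = z := by
      rw [normalizedMap_of_le hz1.le]; linarith
    have fw : normalizedMap β s w = z := by rw [normalizedMap_of_ge hw1, hw]
    have fx : normalizedMap β s x = v := by rw [normalizedMap_of_le hx1]; linarith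
    have fv : normalizedMap β s v = w := by rw [normalizedMap_of_le (by linarith)]; linarith
    have hsβ := mul_pos hs hβ0
    refine ⟨z, ⟨hz0.le, by linarith⟩, w, ⟨by linarith, by linarith⟩, x,
      ⟨by linarith, by linarith⟩, ?_, ?_, ?_, Or.inl ⟨hzx, hxw⟩⟩
    · simp only [Function.comp_apply, fz]
    · simp only [Function.comp_apply, fw, fz]
    · simp only [Function.comp_apply, fx, fv]

end NormalizedMap

/-- Turbulence is invariant under rescaling the coordinate by a positive factor. -/
theorem turbulent_Icc_iff_of_scale {f g : ℝ → ℝ} {c L : ℝ} (hc : 0 < c)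
    (hfg : ∀ y, f (c * y) = c * g y) :
    Turbulent f (Icc 0 L) ↔ Turbulent g (Icc 0 (L / c)) := by
  constructor
  · rintro ⟨x₁, m₁, x₂, m₂, x₃, m₃, e₁, e₂, e₃, H⟩
    have hg : ∀ x, g (x / c) = f x / c := fun x => by
      rw [eq_div_iff hc.ne', mul_comm, ← hfg, mul_div_cancel₀ _ hc.ne']
    have hmem : ∀ x ∈ Icc 0 L, x / c ∈ Icc 0 (L / c) := fun x hx =>
      ⟨div_nonneg hx.1 hc.le, div_le_div_of_nonneg_right hx.2 hc.le⟩
    refine ⟨x₁ / c, hmem _ m₁, x₂ / c, hmem _ m₂, x₃ / c, hmem _ m₃, ?_, ?_, ?_, ?_⟩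
    · rw [hg, e₁]
    · rw [hg, e₂]
    · rw [hg, e₃]
    · simpa only [div_lt_div_iff_of_pos_right hc] using H
  · rintro ⟨x₁, m₁, x₂, m₂, x₃, m₃, e₁, e₂, e₃, H⟩
    have hmem : ∀ x ∈ Icc 0 (L / c), c * x ∈ Icc 0 L := fun x hx =>
      ⟨mul_nonneg hc.le hx.1, by rw [mul_comm]; exact (le_div_iff₀ hc).1 hx.2⟩
    refine ⟨c * x₁, hmem _ m₁, c * x₂, hmem _ m₂, c * x₃, hmem _ m₃, ?_, ?_, ?_, ?_⟩
    · rw [hfg, e₁]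
    · rw [hfg, e₂]
    · rw [hfg, e₃]
    · simpa only [mul_lt_mul_iff_right₀ hc] using H

theorem h_scale {β k μ Y₀ : ℝ} (hY₀ : 0 < Y₀) (hD : 1 - k * Y₀ ≠ 0) (y : ℝ) :
    h β k μ Y₀ (Y₀ * y) = Y₀ * normalizedMap β (μ * k / (1 - k * Y₀) - β) y := by
  have hiff : Y₀ * y ≤ Y₀ ↔ y ≤ 1 := mul_le_iff_le_one_right hY₀
  unfold h normalizedMap
  simp only [hiff]
  split_ifs
  · field_simp
    ring
  · ring

/-- The quadratic condition `s + β ≤ β s²` solved for `s`. -/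
theorem add_le_mul_sq_iff {β s : ℝ} (hβ0 : 0 < β) (hs : 0 < s) :
    s + β ≤ β * s ^ 2 ↔ 1 + Real.sqrt (4 * β ^ 2 + 1) ≤ 2 * β * s := by
  have hr0 : 1 ≤ Real.sqrt (4 * β ^ 2 + 1) := Real.one_le_sqrt.2 (by nlinarith)
  have hr : Real.sqrt (4 * β ^ 2 + 1) ^ 2 = 4 * β ^ 2 + 1 := Real.sq_sqrt (by positivity)
  generalize Real.sqrt (4 * β ^ 2 + 1) = r at hr hr0
  have key : 4 * β * (β * s ^ 2 - (s + β)) = (2 * β * s - 1 - r) * (2 * β * s - 1 + r) := by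
    linear_combination hr
  have h2 : 0 < 2 * β * s - 1 + r := by
    have : 0 < β * s := mul_pos hβ0 hs
    linarith
  constructor
  · intro hle
    have : 0 ≤ (2 * β * s - 1 - r) * (2 * β * s - 1 + r) :=
      key ▸ mul_nonneg (by positivity) (by linarith)
    linarith [nonneg_of_mul_nonneg_left this h2]
  · intro hle
    have : 0 ≤ 4 * β * (β * s ^ 2 - (s + β)) := key ▸ mul_nonneg (by linarith) h2.le
    linarith [nonneg_of_mul_nonneg_right this (by positivity : 0 < 4 * β)]

/-- The second iterate `h²` is turbulent on `E = [0, 1/k]` iff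
`(1+β)(1−kY₀)/k < μ` and `(1−kY₀)(1+2β²+√(4β²+1))/(2βk) ≤ μ`. -/
theorem stmt_15 (β k μ Y₀ : ℝ) (hβ0 : 0 < β) (hβ1 : β < 1) (hk : 0 < k) (hμ : 0 < μ)
    (hY₀ : 0 < Y₀) (hY₀' : Y₀ < 1 / k)
    (hlow : β * (1 - k * Y₀) / k < μ) (hhigh : μ ≤ (1 - k * Y₀) / (k ^ 2 * Y₀)) :
    Turbulent (h β k μ Y₀ ∘ h β k μ Y₀) (Set.Icc 0 (1 / k)) ↔
      ((1 + β) * (1 - k * Y₀) / k < μ ∧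
        (1 - k * Y₀) * (1 + 2 * β ^ 2 + Real.sqrt (4 * β ^ 2 + 1)) / (2 * β * k) ≤ μ) := by
  have hD : 0 < 1 - k * Y₀ := by
    rw [lt_div_iff₀ hk] at hY₀'
    linarith
  obtain ⟨s, hsdef⟩ : ∃ s, s = μ * k / (1 - k * Y₀) - β := ⟨_, rfl⟩
  have hμs : μ * k = (s + β) * (1 - k * Y₀) := by
    rw [hsdef, sub_add_cancel, div_mul_cancel₀ _ hD.ne']
  have hs : 0 < s := by
    rw [div_lt_iff₀ hk, hμs] at hlow
    linarith [lt_of_mul_lt_mul_right hlow hD.le]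
  have hM : s + β ≤ 1 / k / Y₀ := by
    rw [le_div_iff₀ (by positivity)] at hhigh
    rw [div_div, le_div_iff₀ (by positivity)]
    refine le_of_mul_le_mul_right ?_ hD
    linear_combination hhigh - k * Y₀ * hμs
  have hscale : ∀ y, (h β k μ Y₀ ∘ h β k μ Y₀) (Y₀ * y) =
      Y₀ * (normalizedMap β s ∘ normalizedMap β s) y := fun y => by
    simp only [Function.comp_apply, h_scale hY₀ hD.ne', hsdef]
  rw [turbulent_Icc_iff_of_scale hY₀ hscale, turbulent_normalizedMap_sq_iff hβ0 hβ1 hs hM,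
    add_le_mul_sq_iff hβ0 hs]
  have hsecond : (1 - k * Y₀) * (1 + 2 * β ^ 2 + Real.sqrt (4 * β ^ 2 + 1)) / (2 * β * k) ≤ μ ↔
      1 + Real.sqrt (4 * β ^ 2 + 1) ≤ 2 * β * s := by
    rw [div_le_iff₀ (by positivity),
      show μ * (2 * β * k) = (1 - k * Y₀) * (2 * β * (s + β)) by linear_combination 2 * β * hμs,
      mul_le_mul_iff_right₀ hD]
    constructor <;> intro hle <;> linarith
  rw [hsecond]
  refine ⟨fun hle => ⟨?_, hle⟩, And.right⟩
  have hr0 : 1 ≤ Real.sqrt (4 * β ^ 2 + 1) := Real.one_le_sqrt.2 (by nlinarith)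
  have hs1 : 1 < s := by nlinarith
  rw [div_lt_iff₀ hk, hμs]
  exact mul_lt_mul_of_pos_right (by linarith) hD
end

section
/- Let Y ∈ [Y₀, 1/k] and let n be a natural number with βⁿ < Y₀·k. Then there exists i with 1 ≤ i ≤ n such that hⁱ(Y) ∈ [0, Y₀], where hⁱ denotes the i-th iterate of h. -/
open Set

theorem h_eq_mul_of_le {β k μ Y₀ Y : ℝ} (hkY₀ : k * Y₀ < 1) (hY : Y₀ ≤ Y) :
    h β k μ Y₀ Y = β * Y := by
  unfold h
  split_ifs with hle
  · obtain rfl := le_antisymm hle hY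
    have hne : 1 - k * Y ≠ 0 := (sub_pos.2 hkY₀).ne'
    field_simp
    ring
  · rfl

theorem exists_iterate_h_mem_Icc {β k μ Y₀ : ℝ} (hβ : 0 ≤ β) (hkY₀ : k * Y₀ < 1)
    (hY₀ : 0 ≤ Y₀) (m : ℕ) {Y : ℝ} (hY : Y₀ ≤ Y) (hpow : β ^ (m + 1) * Y ≤ Y₀) :
    ∃ i : ℕ, 1 ≤ i ∧ i ≤ m + 1 ∧ (h β k μ Y₀)^[i] Y ∈ Icc 0 Y₀ := by
  induction m generalizing Y with
  | zero =>
    refine ⟨1, le_rfl, le_rfl, ?_⟩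
    rw [Function.iterate_one, h_eq_mul_of_le hkY₀ hY]
    exact ⟨mul_nonneg hβ (hY₀.trans hY), by simpa using hpow⟩
  | succ m ih =>
    rcases le_total (β * Y) Y₀ with hle | hge
    · refine ⟨1, le_rfl, by omega, ?_⟩
      rw [Function.iterate_one, h_eq_mul_of_le hkY₀ hY]
      exact ⟨mul_nonneg hβ (hY₀.trans hY), hle⟩
    · obtain ⟨i, _, hi, hmem⟩ := ih hge (by rwa [← mul_assoc, ← pow_succ])
      refine ⟨i + 1, by omega, by omega, ?_⟩
      rwa [Function.iterate_succ_apply, h_eq_mul_of_le hkY₀ hY]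

/-- If `βⁿ < Y₀·k`, then any orbit starting in `[Y₀, 1/k]` enters `[0, Y₀]`
within `n` steps. -/
theorem stmt_18 (β k μ Y₀ : ℝ) (hβ0 : 0 < β) (hβ1 : β < 1) (hk : 0 < k) (hμ : 0 < μ)
    (hY₀ : 0 < Y₀) (hY₀' : Y₀ < 1 / k)
    (Y : ℝ) (hY : Y ∈ Set.Icc Y₀ (1 / k)) (n : ℕ) (hn : β ^ n < Y₀ * k) :
    ∃ i : ℕ, 1 ≤ i ∧ i ≤ n ∧ (h β k μ Y₀)^[i] Y ∈ Set.Icc 0 Y₀ := by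
  have hkY₀ : k * Y₀ < 1 := by
    rwa [lt_div_iff₀ hk, mul_comm] at hY₀'
  obtain _ | m := n
  · rw [pow_zero] at hn
    linarith
  · refine exists_iterate_h_mem_Icc hβ0.le hkY₀ hY₀.le m hY.1 ?_
    calc β ^ (m + 1) * Y ≤ Y₀ * k * (1 / k) :=
          mul_le_mul hn.le hY.2 (hY₀.le.trans hY.1) (by positivity)
      _ = Y₀ := by field_simp
end

section
/- Assume β₁ < −1. Let n ≥ 1 and let Y ∈ E be such that hⁱ(Y) ≠ Y₀ for every 0 ≤ i < n and hⁱ(Y) < Y₀ for at least one 0 ≤ i < n. Then the n-th iterate hⁿ is differentiable at Y and |(hⁿ)'(Y)| ≥ |β₁|·βⁿ⁻¹; in particular, if |β₁|·βⁿ⁻¹ > 1 then |(hⁿ)'(Y)| > 1. -/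
open Set

theorem hasDerivAt_h_of_lt {β k μ Y₀ y : ℝ} (hy : y < Y₀) :
    HasDerivAt (h β k μ Y₀) (β - μ * k / (1 - k * Y₀)) y := by
  have hlin : HasDerivAt (fun x : ℝ => (β - μ * k / (1 - k * Y₀)) * x + μ / (1 - k * Y₀) - μ)
      (β - μ * k / (1 - k * Y₀)) y := by
    simpa using (((hasDerivAt_id y).const_mul (β - μ * k / (1 - k * Y₀))).add_const
      (μ / (1 - k * Y₀))).sub_const μ
  refine hlin.congr_of_eventuallyEq ?_
  filter_upwards [Iio_mem_nhds hy] with x hx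
  exact if_pos (le_of_lt hx)

theorem hasDerivAt_h_of_gt {β k μ Y₀ y : ℝ} (hy : Y₀ < y) :
    HasDerivAt (h β k μ Y₀) β y := by
  have hlin : HasDerivAt (fun x : ℝ => β * x) β y := by
    simpa using (hasDerivAt_id y).const_mul β
  refine hlin.congr_of_eventuallyEq ?_
  filter_upwards [Ioi_mem_nhds hy] with x hx
  exact if_neg (not_le.mpr hx)

/-- Along an orbit avoiding the kink, the derivative of the `n`-th iterate is at least `β ^ n` in
absolute value, and one factor `β` improves to `|β₁|` when the orbit visits the steep branch. -/
theorem exists_hasDerivAt_iterate_h {β k μ Y₀ : ℝ} (hβ0 : 0 < β)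
    (hle : β ≤ |β - μ * k / (1 - k * Y₀)|) (Y : ℝ) (n : ℕ)
    (havoid : ∀ i : ℕ, i < n → (h β k μ Y₀)^[i] Y ≠ Y₀) :
    ∃ d : ℝ, HasDerivAt ((h β k μ Y₀)^[n]) d Y ∧ β ^ n ≤ |d| ∧
      ((∃ i : ℕ, i < n ∧ (h β k μ Y₀)^[i] Y < Y₀) →
        |β - μ * k / (1 - k * Y₀)| * β ^ (n - 1) ≤ |d|) := by
  induction n with
  | zero => exact ⟨1, by simpa using hasDerivAt_id Y, by simp, by simp⟩
  | succ n ih =>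
    obtain ⟨d, hd, hpow, hsteep⟩ := ih fun i hi => havoid i (hi.trans n.lt_succ_self)
    rw [Function.iterate_succ', Nat.add_sub_cancel]
    rcases lt_or_gt_of_ne (havoid n n.lt_succ_self) with hlt | hgt
    · refine ⟨_, (hasDerivAt_h_of_lt hlt).comp Y hd, ?_, fun _ => ?_⟩
      · rw [abs_mul, pow_succ']
        gcongr
      · rw [abs_mul]
        gcongr
    · refine ⟨_, (hasDerivAt_h_of_gt hgt).comp Y hd, ?_, ?_⟩
      · rw [abs_mul, abs_of_pos hβ0, pow_succ']
        gcongr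
      · rintro ⟨i, hi, hiY⟩
        have hin : i < n :=
          (Nat.lt_succ_iff.mp hi).lt_of_ne fun hin => (hin ▸ hiY).not_gt hgt
        obtain ⟨m, rfl⟩ := Nat.exists_eq_succ_of_ne_zero (Nat.ne_zero_of_lt hin)
        rw [abs_mul, abs_of_pos hβ0, pow_succ', mul_left_comm]
        exact mul_le_mul_of_nonneg_left (hsteep ⟨i, hin, hiY⟩) hβ0.le

/-- Expansiveness of the iterates of `h` along orbits that avoid the kink `Y₀`
and visit the steep branch at least once. -/
theorem stmt_19 (β k μ Y₀ : ℝ) (hβ0 : 0 < β) (hβ1 : β < 1) (hk : 0 < k) (hμ : 0 < μ)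
    (hY₀ : 0 < Y₀) (hY₀' : Y₀ < 1 / k)
    (hβ₁ : β - μ * k / (1 - k * Y₀) < -1)
    (n : ℕ) (hn : 1 ≤ n) (Y : ℝ) (hY : Y ∈ Set.Icc 0 (1 / k))
    (havoid : ∀ i : ℕ, i < n → (h β k μ Y₀)^[i] Y ≠ Y₀)
    (hvisit : ∃ i : ℕ, i < n ∧ (h β k μ Y₀)^[i] Y < Y₀) :
    DifferentiableAt ℝ ((h β k μ Y₀)^[n]) Y ∧
    |β - μ * k / (1 - k * Y₀)| * β ^ (n - 1) ≤ |deriv ((h β k μ Y₀)^[n]) Y| ∧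
    (1 < |β - μ * k / (1 - k * Y₀)| * β ^ (n - 1) →
      1 < |deriv ((h β k μ Y₀)^[n]) Y|) := by
  have hle : β ≤ |β - μ * k / (1 - k * Y₀)| := by
    rw [abs_of_neg (by linarith)]
    linarith
  obtain ⟨d, hd, -, hsteep⟩ := exists_hasDerivAt_iterate_h hβ0 hle Y n havoid
  rw [hd.deriv]
  exact ⟨hd.differentiableAt, hsteep hvisit, fun hgt => hgt.trans_le (hsteep hvisit)⟩
end
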